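/- Let 𝐌 be the Polish space of infinite minimal subshifts. The set { X ∈ 𝐌 : X is a strong Toeplitz subshift of rank 2 and (X,S) is not conjugate to (X,S^{−1}) } is comeager in 𝐌. -/

import Mathlib

namespace ToeplitzFR

open Set

variable {A B C : Type*}

/-- The shift map `S` on `ℤ → A`: `S(x)(i) = x(i+1)`. -/
def shift (x : ℤ → A) : ℤ → A := fun i => x (i + 1)

/-- The inverse shift map `S⁻¹`. -/
def shiftInv (x : ℤ → A) : ℤ → A := fun i => x (i - 1)

/-- The shift by `k`: `S^k`. -/
def shiftBy (k : ℤ) (x : ℤ → A) : ℤ → A := fun i => x (i + k)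

/-- The finite word `x[i, i+n)`. -/
def factorAt (x : ℤ → A) (i : ℤ) (n : ℕ) : List A :=
  (List.range n).map fun j => x (i + j)

/-- `x` is a periodic point of the shift. -/
def IsPeriodicPoint (x : ℤ → A) : Prop := ∃ p : ℕ, 0 < p ∧ ∀ i : ℤ, x (i + p) = x i

def IsAperiodicPoint (x : ℤ → A) : Prop := ¬ IsPeriodicPoint x

/-- `Per_p(x)`. -/
def PerSet (x : ℤ → A) (p : ℕ) : Set ℤ := {i : ℤ | ∀ k : ℤ, x (i + k * p) = x i}

/-- `Per(x) = ⋃_{p>1} Per_p(x)`. -/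
def PerAll (x : ℤ → A) : Set ℤ := {i : ℤ | ∃ p : ℕ, 1 < p ∧ i ∈ PerSet x p}

/-- `x` is a Toeplitz sequence. -/
def IsToeplitz (x : ℤ → A) : Prop := ∀ i : ℤ, ∃ p : ℕ, 1 < p ∧ i ∈ PerSet x p

/-- The shift orbit of `x`. -/
def orbit (x : ℤ → A) : Set (ℤ → A) := {y | ∃ k : ℤ, y = shiftBy k x}

/-- `X` is the Toeplitz subshift generated by the Toeplitz sequence `x`. -/
def ToeplitzGenerates [TopologicalSpace A] (x : ℤ → A) (X : Set (ℤ → A)) : Prop :=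
  IsToeplitz x ∧ X = closure (orbit x)

/-- `X` is a Toeplitz subshift. -/
def IsToeplitzSubshift [TopologicalSpace A] (X : Set (ℤ → A)) : Prop :=
  ∃ x : ℤ → A, ToeplitzGenerates x X

/-- The `p`-skeleton of `x`, with `none` as the blank symbol. -/
noncomputable def Skel (x : ℤ → A) (p : ℕ) : ℤ → Option A :=
  fun i => @ite _ (i ∈ PerSet x p) (Classical.dec _) (some (x i)) none

/-- `p` is an essential period of `x`. -/
def IsEssentialPeriod (x : ℤ → A) (p : ℕ) : Prop :=
  1 < p ∧ ∀ q : ℕ, 0 < q → q < p → ∃ i : ℤ, Skel x p (i + q) ≠ Skel x p i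

/-- `(P n)` is a period structure for `x`. -/
def IsPeriodStructure (x : ℤ → A) (P : ℕ → ℕ) : Prop :=
  StrictMono P ∧ (∀ n, IsEssentialPeriod x (P n)) ∧ (∀ n, P n ∣ P (n+1)) ∧
    ∀ i : ℤ, ∃ n, i ∈ PerSet x (P n)

/-- `q` divides the scale of the Toeplitz subshift `X`. -/
def DividesScale [TopologicalSpace A] (X : Set (ℤ → A)) (q : ℕ) : Prop :=
  ∃ (x : ℤ → A) (P : ℕ → ℕ),
    ToeplitzGenerates x X ∧ IsPeriodStructure x P ∧ ∃ n, q ∣ P n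

/-! ### Directive sequences and S-adic subshifts -/

/-- All morphisms in the directive sequence are non-erasing. -/
def NonErasing {A : ℕ → Type*} (τ : ∀ n, A (n+1) → List (A n)) : Prop :=
  ∀ n a, τ n a ≠ []

/-- The directive sequence has constant length. -/
def ConstantLength {A : ℕ → Type*} (τ : ∀ n, A (n+1) → List (A n)) : Prop :=
  ∀ n, ∀ a b : A (n+1), (τ n a).length = (τ n b).length

/-- The directive sequence is proper. -/
def ProperSeq {A : ℕ → Type*} (τ : ∀ n, A (n+1) → List (A n)) : Prop :=
  ∀ n, ∃ b c : A n, ∀ a : A (n+1), (τ n a).head? = some b ∧ (τ n a).getLast? = some c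

/-- `sadicWordAux τ n k a = τ_{[n, n+k)}(a)`. -/
def sadicWordAux {A : ℕ → Type*} (τ : ∀ n, A (n+1) → List (A n)) (n : ℕ) :
    ∀ k : ℕ, A (n + k) → List (A n)
  | 0, a => [a]
  | (k+1), a => (τ (n+k) a).flatMap (sadicWordAux τ n k)

/-- `word0 τ k a = τ_{[0, k)}(a)` for `a ∈ A k`. -/
def word0 {A : ℕ → Type*} (τ : ∀ n, A (n+1) → List (A n)) :
    ∀ k : ℕ, A k → List (A 0)
  | 0, a => [a]
  | (k+1), a => (τ k a).flatMap (word0 τ k)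

/-- The directive sequence is primitive. -/
def PrimitiveSeq {A : ℕ → Type*} (τ : ∀ n, A (n+1) → List (A n)) : Prop :=
  ∀ n, ∃ k : ℕ, 0 < k ∧ ∀ (a : A (n+k)) (b : A n), b ∈ sadicWordAux τ n k a

/-- The `n`-th level `X_τ^{(n)}` of the S-adic system generated by `τ`. -/
def XLevel {A : ℕ → Type*} (τ : ∀ n, A (n+1) → List (A n)) (n : ℕ) :
    Set (ℤ → A n) :=
  {y | ∀ (i : ℤ) (m : ℕ), ∃ k : ℕ, 0 < k ∧ ∃ a : A (n+k),
      (factorAt y i m).IsInfix (sadicWordAux τ n k a)}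

/-- The alphabet rank (`liminf_n |A_n|`) is at most `K`. -/
def AlphabetRankLE (A : ℕ → Type*) [∀ n, Fintype (A n)] (K : ℕ) : Prop :=
  ∀ N : ℕ, ∃ n, N ≤ n ∧ Fintype.card (A n) ≤ K

/-! ### Recognizability -/

/-- `z` is the bi-infinite concatenation `⋯σ(y(-1)).σ(y(0))σ(y(1))⋯`,
with `σ(y(0))` starting at coordinate `0`. -/
def IsConcat (σ : B → List C) (y : ℤ → B) (z : ℤ → C) : Prop :=
  ∃ c : ℤ → ℤ, c 0 = 0 ∧ (∀ j : ℤ, c (j + 1) = c j + (σ (y j)).length) ∧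
    ∀ (j : ℤ) (m : Fin (σ (y j)).length), z (c j + (m : ℕ)) = (σ (y j)).get m

/-- `(y, k)` is a centered `σ`-representation of `x` in `Y`. -/
def IsCenteredRep (σ : B → List C) (Y : Set (ℤ → B)) (x : ℤ → C)
    (y : ℤ → B) (k : ℕ) : Prop :=
  y ∈ Y ∧ k < (σ (y 0)).length ∧ IsConcat σ y (fun m => x (m - k))

/-- The morphism `σ` is recognizable in `Y`. -/
def RecognizableIn (σ : B → List C) (Y : Set (ℤ → B)) : Prop :=
  ∀ (x : ℤ → C) (y y' : ℤ → B) (k k' : ℕ),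
    IsCenteredRep σ Y x y k → IsCenteredRep σ Y x y' k' → y = y' ∧ k = k'

/-- The directive sequence `τ` is recognizable. -/
def RecognizableSeq {A : ℕ → Type*} (τ : ∀ n, A (n+1) → List (A n)) : Prop :=
  ∀ n, RecognizableIn (τ n) (XLevel τ (n+1))

/-! ### Conjugacy -/

/-- `(X, TX)` and `(Y, TY)` are conjugate via a homeomorphism. -/
def ConjugateBy [TopologicalSpace A] [TopologicalSpace B]
    (X : Set (ℤ → A)) (Y : Set (ℤ → B))
    (TX : (ℤ → A) → (ℤ → A)) (TY : (ℤ → B) → (ℤ → B)) : Prop :=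
  ∃ φ : ↥X ≃ₜ ↥Y, ∀ (x : ℤ → A) (hx : x ∈ X) (hx' : TX x ∈ X),
    (φ ⟨TX x, hx'⟩).1 = TY (φ ⟨x, hx⟩).1

/-- `(X, S)` and `(Y, S)` are conjugate subshifts. -/
def Conjugate [TopologicalSpace A] [TopologicalSpace B]
    (X : Set (ℤ → A)) (Y : Set (ℤ → B)) : Prop :=
  ConjugateBy X Y shift shift

/-- `X` is a strong Toeplitz subshift of rank `K`: it is conjugate to the S-adic subshift
of a constant-length, primitive, proper and recognizable directive sequence of
alphabet rank at most `K`. -/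
def IsStrongToeplitzOfRank [TopologicalSpace A] (X : Set (ℤ → A)) (K : ℕ) : Prop :=
  ∃ (B : ℕ → Type) (iB : ∀ n, Fintype (B n)) (σ : ∀ n, B (n+1) → List (B n)),
    NonErasing σ ∧ ConstantLength σ ∧ PrimitiveSeq σ ∧ ProperSeq σ ∧
    RecognizableSeq σ ∧ @AlphabetRankLE B iB K ∧
    @Conjugate A (B 0) _ ⊥ X (XLevel σ 0)

/-- `X` is conjugate to the S-adic subshift of a primitive, proper and recognizable
directive sequence of alphabet rank at most `K`. -/
def HasFiniteRankSAdicRep [TopologicalSpace A] (X : Set (ℤ → A)) (K : ℕ) : Prop :=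
  ∃ (B : ℕ → Type) (iB : ∀ n, Fintype (B n)) (σ : ∀ n, B (n+1) → List (B n)),
    NonErasing σ ∧ PrimitiveSeq σ ∧ ProperSeq σ ∧
    RecognizableSeq σ ∧ @AlphabetRankLE B iB K ∧
    @Conjugate A (B 0) _ ⊥ X (XLevel σ 0)

/-! ### Cuts, languages, built-from -/

/-- The set of words `{x[t+kp, t+(k+1)p) : k ∈ ℤ}`. -/
def cutWords (x : ℤ → A) (p t : ℕ) : Set (List A) :=
  {w | ∃ k : ℤ, w = factorAt x ((t : ℤ) + k * p) p}

/-- `(p, t)` is a strong rank-2 cut of `x`. -/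
def StrongRank2Cut (x : ℤ → A) (p t : ℕ) : Prop :=
  t < p ∧ ∃ u v : List A, u ≠ v ∧ cutWords x p t = {u, v}

/-- The language `L_n(X)`. -/
def Lang (n : ℕ) (X : Set (ℤ → A)) : Set (List A) :=
  {w | ∃ x ∈ X, ∃ i : ℤ, w = factorAt x i n}

/-- The maximal common prefix of `u` and `v` has length greater than `m`. -/
def CommonPrefixLongerThan (u v : List A) (m : ℕ) : Prop :=
  m + 1 ≤ u.length ∧ m + 1 ≤ v.length ∧ u.take (m+1) = v.take (m+1)

/-- The maximal common suffix of `u` and `v` has length greater than `m`. -/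
def CommonSuffixLongerThan (u v : List A) (m : ℕ) : Prop :=
  CommonPrefixLongerThan u.reverse v.reverse m

/-- `b = (β₀, (α₁, …, α_k), β₁)` is a building of the word `w` from `W`:
`w = β₀α₁⋯α_kβ₁`, all `αᵢ ∈ W`, `β₀` is a proper suffix of an element of `W`,
and `β₁` is a proper prefix of an element of `W`. -/
def IsBuilding (W : Set (List A)) (w : List A)
    (b : List A × List (List A) × List A) : Prop :=
  w = b.1 ++ b.2.1.flatten ++ b.2.2 ∧ (∀ α ∈ b.2.1, α ∈ W) ∧
  (∃ u ∈ W, b.1 <:+ u ∧ b.1 ≠ u) ∧ (∃ u ∈ W, b.2.2 <+: u ∧ b.2.2 ≠ u)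

/-- `w` is uniquely built from `W`. -/
def UniquelyBuiltFrom (W : Set (List A)) (w : List A) : Prop :=
  ∃! b : List A × List (List A) × List A, IsBuilding W w b

/-- `X` together with one of its points satisfies the strong rank-2 cut property. -/
def GoodCuts [TopologicalSpace A] (X : Set (ℤ → A)) (x : ℤ → A) : Prop :=
  ∀ p : ℕ, 0 < p → DividesScale X p → ∀ m : ℕ,
    ∃ q t : ℕ, StrongRank2Cut x q t ∧ p ∣ q ∧ DividesScale X q ∧
      ∃ u v : List A, u ≠ v ∧ cutWords x q t = {u, v} ∧
        CommonPrefixLongerThan u v m ∧ CommonSuffixLongerThan u v m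

/-! ### Euclidean pairs and buildings of bi-infinite sequences -/

/-- `{u, v}` is a Euclidean pair. -/
def EuclideanPair (u v : List A) : Prop :=
  ∃ (w : List A) (k l : ℕ),
    u = (List.replicate k w).flatten ∧ v = (List.replicate l w).flatten

/-- `α` is the distinguished prefix of `u` and `v`. -/
def IsDistinguishedPrefix (u v α : List A) : Prop :=
  α.length < u.length + v.length ∧
  ∀ x y : List A,
    (∃ l : List (List A), (∀ w ∈ l, w = u ∨ w = v) ∧ x = u ++ l.flatten) →
    (∃ l : List (List A), (∀ w ∈ l, w = u ∨ w = v) ∧ y = v ++ l.flatten) →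
    α.length + 1 ≤ x.length → α.length + 1 ≤ y.length →
    α <+: x ∧ α <+: y ∧ x[α.length]? ≠ y[α.length]?

/-- `β` is the distinguished suffix of `u` and `v`. -/
def IsDistinguishedSuffix (u v β : List A) : Prop :=
  IsDistinguishedPrefix u.reverse v.reverse β.reverse

/-- `(c, f)` is a building of the bi-infinite sequence `x` from `W`:
block `j` starts at position `c j` and carries the word `f j ∈ W`. -/
def IsBuildingSeq (W : Set (List A)) (x : ℤ → A) (c : ℤ → ℤ) (f : ℤ → List A) : Prop :=
  (∀ j : ℤ, f j ∈ W) ∧ (∀ j : ℤ, c (j + 1) = c j + (f j).length) ∧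
  ∀ (j : ℤ) (m : Fin (f j).length), x (c j + (m : ℕ)) = (f j).get m

/-- The subshift `X_{u,v}` of all sequences built from `{u, v}`. -/
def Xuv (u v : List A) : Set (ℤ → A) :=
  {x | ∃ (c : ℤ → ℤ) (f : ℤ → List A), IsBuildingSeq {u, v} x c f}

/-! ### Block-code conjugacies -/

/-- A conjugacy `φ : X → Y` admitting block width `2n+1`. -/
structure BlockConjugacy (A : Type*) (X Y : Set (ℤ → A)) (n : ℕ) where
  toFun : (ℤ → A) → (ℤ → A)
  invFun : (ℤ → A) → (ℤ → A)
  maps_to : ∀ x ∈ X, toFun x ∈ Y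
  maps_from : ∀ y ∈ Y, invFun y ∈ X
  left_inv : ∀ x ∈ X, invFun (toFun x) = x
  right_inv : ∀ y ∈ Y, toFun (invFun y) = y
  shift_comm : ∀ x ∈ X, toFun (shift x) = shift (toFun x)
  code : List A → A
  code_inv : List A → A
  code_spec : ∀ x ∈ X, ∀ i : ℤ, toFun x i = code (factorAt x (i - n) (2*n+1))
  code_inv_spec : ∀ y ∈ Y, ∀ i : ℤ, invFun y i = code_inv (factorAt y (i - n) (2*n+1))

/-! ### Parts, permutation action, χ -/

/-- `W` is a member of `Parts(X, p)`: a class of the common-`p`-skeleton relation. -/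
def SkelClass (X : Set (ℤ → A)) (p : ℕ) (W : Set (ℤ → A)) : Prop :=
  ∃ y ∈ X, W = {z ∈ X | Skel z p = Skel y p}

/-- The map `ψ̂` induced by a permutation `ψ` of `A^p`. -/
def permHat (p : ℕ) (ψ : Equiv.Perm (Fin p → A)) (x : ℤ → A) : ℤ → A :=
  fun i =>
    if h : (i.emod p).toNat < p then
      ψ (fun m : Fin p => x (i - i.emod p + (m : ℕ))) ⟨(i.emod p).toNat, h⟩
    else x i

/-- The relation `E_p` on compact subsets of `A^ℤ`. -/
def EpRel (p : ℕ) (K L : Set (ℤ → A)) : Prop :=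
  ∃ ψ : Equiv.Perm (Fin p → A), L = permHat p ψ '' K

/-- `W ∈ Parts_*(X, p)`. -/
def SkelClassStar (X : Set (ℤ → A)) (p : ℕ) (W : Set (ℤ → A)) : Prop :=
  SkelClass X p W ∧ ∀ y ∈ W, Skel y p (-1) = none ∧ Skel y p 0 ≠ none

/-- `length(W) = L` for `W ∈ Parts_*(X, p)`. -/
def HasLength (p : ℕ) (W : Set (ℤ → A)) (L : ℕ) : Prop :=
  ∀ y ∈ W, (∀ i : ℕ, i < L → Skel y p (i : ℤ) ≠ none) ∧ Skel y p (L : ℤ) = none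

/-- `Z ∈ χ(X, p)`. -/
def ChiMem (X : Set (ℤ → A)) (p : ℕ) (Z : Set (ℤ → A)) : Prop :=
  ∃ (W : Set (ℤ → A)) (L : ℕ), SkelClassStar X p W ∧ HasLength p W L ∧
    (∀ (W' : Set (ℤ → A)) (L' : ℕ),
      SkelClassStar X p W' → HasLength p W' L' → L' ≤ L) ∧
    Z = shiftBy ((L / 2 : ℕ) : ℤ) '' W

/-- `χ(X, p) E_p^fin χ(Y, p)`. -/
def ChiEpFin (X Y : Set (ℤ → A)) (p : ℕ) : Prop :=
  (∀ K, ChiMem X p K → ∃ L, ChiMem Y p L ∧ EpRel p K L) ∧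
  (∀ L, ChiMem Y p L → ∃ K, ChiMem X p K ∧ EpRel p K L)

/-! ### Single holes and fillings -/

/-- The Toeplitz sequence `x` has single holes with respect to the period structure `P`. -/
def SingleHoles (x : ℤ → A) (P : ℕ → ℕ) : Prop :=
  IsPeriodStructure x P ∧
  ∀ n, ∃! i : ℤ, 0 ≤ i ∧ i < (P n : ℤ) ∧ i ∉ PerSet x (P n)

/-- The Toeplitz subshift `X` has single holes. -/
def HasSingleHoles [TopologicalSpace A] (X : Set (ℤ → A)) : Prop :=
  ∃ (x : ℤ → A) (P : ℕ → ℕ), ToeplitzGenerates x X ∧ SingleHoles x P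

/-- `w` is the `(n, m)`-filling of `x` (for periods `pn < pm`). -/
def IsFilling (x : ℤ → A) (pn pm : ℕ) (w : List A) : Prop :=
  w.length = pm / pn - 1 ∧
  ∀ h : ℤ, 0 ≤ h → h < (pm : ℤ) → h ∉ PerSet x pm →
    ∀ (j : ℕ) (hj : j < w.length), w.get ⟨j, hj⟩ = x (h + (j+1) * pn)

/-- `u` is a `θ`-palindrome. -/
def ThetaPalindrome (θ : Equiv.Perm A) (u : List A) : Prop :=
  u.map (fun a => θ a) = u.reverse

/-! ### Nice symmetries -/

/-- `x` has nice symmetries with respect to `(p, q)`. -/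
def NiceSymmetries (x : ℤ → A) (p q : ℕ) : Prop :=
  ∃ m : ℤ, 1 < m ∧ m ≤ (q : ℤ) + 1 ∧
    (∀ k : ℕ, k < q / p →
      (Set.Ico ((k * p : ℕ) : ℤ) (((k+1) * p : ℕ) : ℤ) ⊆ PerSet x q ↔
       Set.Ico (m - ((k+1) * p : ℕ)) (m - (k * p : ℕ)) ⊆ PerSet x q)) ∧
    (∀ k k' : ℕ, k < q / p → k' < q / p →
      Set.Ico ((k * p : ℕ) : ℤ) (((k+1) * p : ℕ) : ℤ) ⊆ PerSet x q →
      Set.Ico ((k' * p : ℕ) : ℤ) (((k'+1) * p : ℕ) : ℤ) ⊆ PerSet x q →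
      (factorAt x ((k * p : ℕ) : ℤ) p = factorAt x ((k' * p : ℕ) : ℤ) p ↔
       factorAt x (m - ((k+1) * p : ℕ)) p = factorAt x (m - ((k'+1) * p : ℕ)) p))

/-- For some `p` dividing the scale of `X`, `x` has nice symmetries with respect to
`(p, q)` for all `q > p` with `p ∣ q` dividing the scale of `X`. -/
def NiceSymAll [TopologicalSpace A] (X : Set (ℤ → A)) (x : ℤ → A) : Prop :=
  ∃ p : ℕ, 0 < p ∧ DividesScale X p ∧
    ∀ q : ℕ, p < q → p ∣ q → DividesScale X q → NiceSymmetries x p q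

/-- A pair `(x, x')` is a centered left asymptotic pair. -/
def CenteredLeftAsymptoticPair (x x' : ℤ → A) : Prop :=
  (∀ i : ℤ, i < 0 → x i = x' i) ∧ x 0 ≠ x' 0

/-! ### Automorphism groups -/

/-- `e` is an automorphism of the subshift `(X, S)`. -/
def IsShiftAutomorphism [TopologicalSpace A] (X : Set (ℤ → A)) (e : ↥X ≃ₜ ↥X) : Prop :=
  ∀ (x : ℤ → A) (hx : x ∈ X) (hx' : shift x ∈ X),
    (e ⟨shift x, hx'⟩).1 = shift (e ⟨x, hx⟩).1

/-- The automorphism group of `(X, S)` is isomorphic, as a group, to `ℤ × ℤ/nℤ`. -/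
def AutGroupIsoZxZmod [TopologicalSpace A] (X : Set (ℤ → A)) (n : ℕ) : Prop :=
  ∃ Φ : {e : ↥X ≃ₜ ↥X // IsShiftAutomorphism X e} → ℤ × ZMod n,
    Function.Bijective Φ ∧
    ∀ e f g : {e : ↥X ≃ₜ ↥X // IsShiftAutomorphism X e},
      (∀ z : ↥X, g.1 z = e.1 (f.1 z)) → Φ g = Φ e + Φ f

/-! ### The Polish space of subshifts over `ℤ` -/

/-- A point of the space `𝐒` of all (compact, nonempty, shift-invariant) subshifts
over finite alphabets contained in `ℤ`. -/
structure SubshiftSpace : Type where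
  carrier : Set (ℤ → ℤ)
  nonempty : carrier.Nonempty
  compact : IsCompact carrier
  invariant : shift '' carrier = carrier

/-- The topology on `𝐒` induced by the languages `(L_n(X))_{n}`, with each
family of `n`-languages discrete; this coincides with the metric
`d(X,Y) = 2^{-min{n : L_n(X) ≠ L_n(Y)}}`. -/
instance : TopologicalSpace SubshiftSpace :=
  TopologicalSpace.induced
    (fun X : SubshiftSpace => (fun n => Lang n X.carrier : ℕ → Set (List ℤ)))
    (@Pi.topologicalSpace ℕ (fun _ => Set (List ℤ)) (fun _ => ⊥))

/-- The subset `𝐌 ⊆ 𝐒` of infinite minimal subshifts. -/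
def MinimalSet : Set SubshiftSpace :=
  {X | X.carrier.Infinite ∧ ∀ x ∈ X.carrier, X.carrier ⊆ closure (orbit x)}


section Part1

/-! ### Part 1: basic facts -/

/-- Working hypotheses on a subshift. -/
structure GoodS (X : Set (ℤ → ℤ)) : Prop where
  ne : X.Nonempty
  cpt : IsCompact X
  inv : ∀ x ∈ X, ∀ k : ℤ, shiftBy k x ∈ X
  inf : X.Infinite
  mini : ∀ x ∈ X, X ⊆ closure (orbit x)

lemma shiftBy_shiftBy {A : Type*} (a b : ℤ) (x : ℤ → A) :
    shiftBy a (shiftBy b x) = shiftBy (a + b) x := by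
  funext i; simp [shiftBy, add_assoc]

lemma shiftBy_zero {A : Type*} (x : ℤ → A) : shiftBy 0 x = x := by
  funext i; simp [shiftBy]

lemma shift_eq {A : Type*} (x : ℤ → A) : shift x = shiftBy 1 x := rfl

lemma shiftBy_inv_of {X : Set (ℤ → ℤ)} (h : shift '' X = X) :
    ∀ x ∈ X, ∀ k : ℤ, shiftBy k x ∈ X := by
  have h1 : ∀ x ∈ X, shiftBy 1 x ∈ X := fun x hx => h ▸ ⟨x, hx, rfl⟩
  have h2 : ∀ x ∈ X, shiftBy (-1) x ∈ X := by
    intro x hx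
    have hx' := hx
    rw [← h] at hx'
    obtain ⟨y, hy, rfl⟩ := hx'
    rw [shift_eq, shiftBy_shiftBy]
    simpa [shiftBy_zero] using hy
  intro x hx k
  induction k using Int.induction_on with
  | zero => simpa [shiftBy_zero] using hx
  | succ i ih =>
    have := h1 _ ih
    rw [shiftBy_shiftBy] at this
    rwa [add_comm]
  | pred i ih =>
    have := h2 _ ih
    rw [shiftBy_shiftBy] at this
    rwa [sub_eq_add_neg, add_comm]

lemma goodS_of_mem (X : SubshiftSpace) (hX : X ∈ MinimalSet) : GoodS X.carrier :=
  ⟨X.nonempty, X.compact, shiftBy_inv_of X.invariant, hX.1, hX.2⟩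

lemma continuous_shiftBy {A : Type*} [TopologicalSpace A] (k : ℤ) :
    Continuous (shiftBy k : (ℤ → A) → (ℤ → A)) := by
  unfold shiftBy; fun_prop

/-- The cylinder of points agreeing with `x` on `[-M, M]`. -/
def Cyl (x : ℤ → ℤ) (M : ℕ) : Set (ℤ → ℤ) := {y | ∀ i : ℤ, |i| ≤ M → y i = x i}

lemma isOpen_cyl (x : ℤ → ℤ) (M : ℕ) : IsOpen (Cyl x M) := by
  have : Cyl x M = ⋂ i ∈ Set.Icc (-(M : ℤ)) M, {y | y i = x i} := by
    ext y; simp [Cyl, abs_le]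
  rw [this]
  refine (Set.finite_Icc _ _).isOpen_biInter ?_
  intro i _
  have := (isOpen_discrete ({x i} : Set ℤ)).preimage (continuous_apply (A := fun _ : ℤ => ℤ) i)
  exact this

lemma exists_cyl_subset {O : Set (ℤ → ℤ)} (hO : IsOpen O) {x : ℤ → ℤ} (hx : x ∈ O) :
    ∃ M : ℕ, Cyl x M ⊆ O := by
  rw [isOpen_pi_iff] at hO
  obtain ⟨I, w, h1, h2⟩ := hO x hx
  refine ⟨I.sup (fun i => i.natAbs), fun y hy => h2 ?_⟩
  intro i hi
  have : y i = x i := by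
    apply hy
    have : i.natAbs ≤ I.sup (fun i => i.natAbs) := Finset.le_sup (f := fun i : ℤ => i.natAbs) hi
    rw [abs_le]; constructor <;> omega
  rw [this]; exact (h1 i hi).2

/-- `O` depends on finitely many coordinates only. -/
def Win (O : Set (ℤ → ℤ)) : Prop :=
  ∃ M : ℕ, ∀ x y : ℤ → ℤ, (∀ i : ℤ, |i| ≤ M → x i = y i) → x ∈ O → y ∈ O

lemma Win.isOpen {O : Set (ℤ → ℤ)} (h : Win O) : IsOpen O := by
  obtain ⟨M, hM⟩ := h
  rw [isOpen_iff_mem_nhds]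
  intro x hx
  exact Filter.mem_of_superset ((isOpen_cyl x M).mem_nhds (fun i _ => rfl))
    (fun y hy => hM x y (fun i hi => (hy i hi).symm) hx)

lemma Win.compl {O : Set (ℤ → ℤ)} (h : Win O) : Win Oᶜ := by
  obtain ⟨M, hM⟩ := h
  exact ⟨M, fun x y hxy hx hy => hx (hM y x (fun i hi => (hxy i hi).symm) hy)⟩

lemma Win.isClosed {O : Set (ℤ → ℤ)} (h : Win O) : IsClosed O :=
  ⟨h.compl.isOpen⟩

lemma Win.inter {O P : Set (ℤ → ℤ)} (h : Win O) (h' : Win P) : Win (O ∩ P) := by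
  obtain ⟨M, hM⟩ := h
  obtain ⟨M', hM'⟩ := h'
  refine ⟨max M M', fun x y hxy hx => ⟨hM x y (fun i hi => hxy i ?_) hx.1,
    hM' x y (fun i hi => hxy i ?_) hx.2⟩⟩
  · exact hi.trans (by exact_mod_cast le_max_left _ _)
  · exact hi.trans (by exact_mod_cast le_max_right _ _)

lemma Win.shift {O : Set (ℤ → ℤ)} (h : Win O) (k : ℤ) : Win {x | shiftBy k x ∈ O} := by
  obtain ⟨M, hM⟩ := h
  refine ⟨M + k.natAbs, fun x y hxy hx => hM _ _ (fun i hi => ?_) hx⟩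
  apply hxy
  rw [abs_le] at *
  rw [Nat.cast_add]
  constructor <;> omega

lemma win_eq (a b : ℤ) (w : ℤ → ℤ) : Win {x | ∀ i, a ≤ i → i < b → x i = w i} := by
  refine ⟨a.natAbs + b.natAbs, fun x y hxy hx i hi hi' => ?_⟩
  rw [← hxy i, hx i hi hi']
  rw [abs_le, Nat.cast_add]; constructor <;> omega

/-- Minimality: every orbit visits every nonempty open set. -/
lemma GoodS.visit {X : Set (ℤ → ℤ)} (h : GoodS X) {x y : ℤ → ℤ} (hx : x ∈ X) (hy : y ∈ X)
    {O : Set (ℤ → ℤ)} (hO : IsOpen O) (hyO : y ∈ O) : ∃ k : ℤ, shiftBy k x ∈ O := by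
  have := h.mini x hx hy
  rw [mem_closure_iff] at this
  obtain ⟨z, hz, k, rfl⟩ := this O hO hyO
  exact ⟨k, hz⟩

/-- Minimality: visits are syndetic. -/
lemma GoodS.synd {X : Set (ℤ → ℤ)} (h : GoodS X) {y : ℤ → ℤ} (hy : y ∈ X)
    {O : Set (ℤ → ℤ)} (hO : IsOpen O) (hyO : y ∈ O) :
    ∃ R : ℕ, ∀ x ∈ X, ∃ i : ℤ, 0 ≤ i ∧ i < R ∧ shiftBy i x ∈ O := by
  have hcov : X ⊆ ⋃ k : ℤ, (shiftBy k) ⁻¹' O := by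
    intro x hx
    obtain ⟨k, hk⟩ := h.visit hx hy hO hyO
    exact mem_iUnion.2 ⟨k, hk⟩
  obtain ⟨t, ht⟩ := h.cpt.elim_finite_subcover _
    (fun k : ℤ => hO.preimage (continuous_shiftBy k)) hcov
  set M := t.sup (fun i => i.natAbs) with hM
  refine ⟨2 * M + 1, fun x hx => ?_⟩
  have := ht (h.inv x hx M)
  simp only [mem_iUnion, mem_preimage, exists_prop] at this
  obtain ⟨k, hk, hk'⟩ := this
  have hle : k.natAbs ≤ M := Finset.le_sup (f := fun i : ℤ => i.natAbs) hk
  rw [shiftBy_shiftBy] at hk'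
  exact ⟨k + M, by omega, by push_cast; omega, hk'⟩

/-- The key property. -/
def CutProp (k : ℕ) (X : Set (ℤ → ℤ)) : Prop :=
  ∃ (p N : ℕ) (E : Set (ℤ → ℤ)) (u v : ℤ → ℤ), 0 < p ∧ (∀ q : ℕ, 0 < q → q ≤ k → q ∣ p) ∧
    (∀ x y : ℤ → ℤ, (∀ i : ℤ, 0 ≤ i → i < N → x i = y i) → x ∈ E → y ∈ E) ∧
    (∀ x ∈ X, ∃! t : ℤ, 0 ≤ t ∧ t < p ∧ shiftBy t x ∈ E) ∧
    (∀ x ∈ X, x ∈ E → (∀ i : ℤ, 0 ≤ i → i < p → x i = u i) ∨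
      (∀ i : ℤ, 0 ≤ i → i < p → x i = v i)) ∧
    (∀ i : ℤ, 0 ≤ i → i < k → u i = v i) ∧ (∀ i : ℤ, (p : ℤ) - k ≤ i → i < p → u i = v i) ∧
    ¬ ∃ c : ℤ, ∀ h : ℤ, 0 ≤ h → h < p → u h ≠ v h →
      ∃ h' q : ℤ, 0 ≤ h' ∧ h' < p ∧ u h' ≠ v h' ∧ |h + h' - c - q * p| ≤ k

/-! ### Languages and the topology -/

lemma factorAt_eq {A : Type*} (x : ℤ → A) (i : ℤ) (n : ℕ) :
    factorAt x i n = (List.range n).map (fun j : ℕ => x (i + (j : ℤ))) := by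
  unfold factorAt
  simp only [List.bind_eq_flatMap, List.pure_def, List.map_flatMap, List.map_cons, List.map_nil]
  induction n with
  | zero => rfl
  | succ n ih => rw [List.range_succ, List.flatMap_append, ih]; simp

lemma factorAt_ext {A : Type*} {x y : ℤ → A} {i j : ℤ} {n : ℕ} :
    factorAt x i n = factorAt y j n ↔ ∀ t : ℤ, 0 ≤ t → t < n → x (i + t) = y (j + t) := by
  rw [factorAt_eq, factorAt_eq, List.map_inj_left]
  constructor
  · intro h t h0 h1
    have := h t.toNat (by simp; omega)
    simpa [Int.toNat_of_nonneg h0] using this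
  · intro h a ha
    exact h a (by positivity) (by exact_mod_cast List.mem_range.1 ha)

lemma factorAt_length {A : Type*} (x : ℤ → A) (i : ℤ) (n : ℕ) : (factorAt x i n).length = n := by
  simp [factorAt_eq]

lemma factorAt_take {A : Type*} (x : ℤ → A) (i : ℤ) {n m : ℕ} (h : m ≤ n) :
    (factorAt x i n).take m = factorAt x i m := by
  simp [factorAt_eq, ← List.map_take, List.take_range, min_eq_left h]

lemma lang_mono {X Y : Set (ℤ → ℤ)} {n m : ℕ} (h : m ≤ n) (hXY : Lang n X = Lang n Y) :
    Lang m X = Lang m Y := by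
  have key : ∀ Z : Set (ℤ → ℤ), Lang m Z = (List.take m) '' (Lang n Z) := by
    intro Z
    ext w
    constructor
    · rintro ⟨x, hx, i, rfl⟩
      exact ⟨_, ⟨x, hx, i, rfl⟩, factorAt_take x i h⟩
    · rintro ⟨_, ⟨x, hx, i, rfl⟩, rfl⟩
      exact ⟨x, hx, i, factorAt_take x i h⟩
  rw [key, key, hXY]

lemma lang_transfer {X Y : Set (ℤ → ℤ)} {n : ℕ} (hinv : ∀ x ∈ X, ∀ k : ℤ, shiftBy k x ∈ X)
    (h : Lang n Y = Lang n X) {y : ℤ → ℤ} (hy : y ∈ Y) :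
    ∃ x ∈ X, ∀ i : ℤ, 0 ≤ i → i < n → x i = y i := by
  have : factorAt y 0 n ∈ Lang n X := h ▸ ⟨y, hy, 0, rfl⟩
  obtain ⟨x, hx, i, hi⟩ := this
  refine ⟨shiftBy i x, hinv x hx i, fun t h0 h1 => ?_⟩
  have := factorAt_ext.1 hi t h0 h1
  simpa [shiftBy, add_comm] using this.symm

lemma cutProp_open {k : ℕ} {X : Set (ℤ → ℤ)} (hinv : ∀ x ∈ X, ∀ k : ℤ, shiftBy k x ∈ X)
    (h : CutProp k X) : ∃ n : ℕ, ∀ Y : Set (ℤ → ℤ), Lang n Y = Lang n X → CutProp k Y := by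
  obtain ⟨p, N, E, u, v, hp, hq, hE, hX, huv, h1, h2, h3⟩ := h
  refine ⟨N + p, fun Y hY => ⟨p, N, E, u, v, hp, hq, hE, ?_, ?_, h1, h2, h3⟩⟩
  · intro y hy
    obtain ⟨x, hx, hxy⟩ := lang_transfer hinv hY hy
    obtain ⟨t, ⟨ht0, ht1, ht2⟩, htu⟩ := hX x hx
    have tr : ∀ s : ℤ, 0 ≤ s → s < p → (shiftBy s x ∈ E ↔ shiftBy s y ∈ E) := by
      intro s hs0 hs1
      have : ∀ i : ℤ, 0 ≤ i → i < N → shiftBy s x i = shiftBy s y i := by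
        intro i hi0 hi1
        exact hxy _ (by omega) (by push_cast; omega)
      exact ⟨hE _ _ this, hE _ _ (fun i a b => (this i a b).symm)⟩
    refine ⟨t, ⟨ht0, ht1, (tr t ht0 ht1).1 ht2⟩, ?_⟩
    rintro s ⟨hs0, hs1, hs2⟩
    exact htu s ⟨hs0, hs1, (tr s hs0 hs1).2 hs2⟩
  · intro y hy hyE
    obtain ⟨x, hx, hxy⟩ := lang_transfer hinv hY hy
    have hxE : x ∈ E := hE y x (fun i a b => (hxy i a (by push_cast; omega)).symm) hyE
    rcases huv x hx hxE with h | h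
    · exact Or.inl fun i a b => by rw [← hxy i a (by push_cast; omega)]; exact h i a b
    · exact Or.inr fun i a b => by rw [← hxy i a (by push_cast; omega)]; exact h i a b

lemma isOpen_langEq (n : ℕ) (S : Set (List ℤ)) : IsOpen {Y : SubshiftSpace | Lang n Y.carrier = S} := by
  let : TopologicalSpace (Set (List ℤ)) := ⊥
  have : DiscreteTopology (Set (List ℤ)) := ⟨rfl⟩
  refine ⟨{f | f n = S}, ?_, rfl⟩
  exact (isOpen_discrete {S}).preimage (continuous_apply (A := fun _ : ℕ => Set (List ℤ)) n)

lemma exists_lang_nhds {O : Set SubshiftSpace} (hO : IsOpen O) {X : SubshiftSpace} (hX : X ∈ O) :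
    ∃ n : ℕ, ∀ Y : SubshiftSpace, Lang n Y.carrier = Lang n X.carrier → Y ∈ O := by
  let : TopologicalSpace (Set (List ℤ)) := ⊥
  obtain ⟨V, hV, rfl⟩ := hO
  rw [isOpen_pi_iff] at hV
  obtain ⟨I, w, h1, h2⟩ := hV _ hX
  refine ⟨I.sup id, fun Y hY => h2 ?_⟩
  intro i hi
  have hle : i ≤ I.sup id := Finset.le_sup (f := id) hi
  have := lang_mono hle hY
  show Lang i Y.carrier ∈ w i
  rw [this]; exact (h1 i hi).2

/-- Reduction of the theorem to density and consequences of `CutProp`. -/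
lemma residual_of {T : Set ↥MinimalSet}
    (hd : ∀ X : SubshiftSpace, X ∈ MinimalSet → ∀ n k : ℕ, ∃ Y : SubshiftSpace, Y ∈ MinimalSet ∧
      Lang n Y.carrier = Lang n X.carrier ∧ CutProp k Y.carrier)
    (hT : ∀ X : ↥MinimalSet, (∀ k, CutProp k (X : SubshiftSpace).carrier) → X ∈ T) :
    T ∈ residual ↥MinimalSet := by
  have h : (⋂ k : ℕ, {X : ↥MinimalSet | CutProp k (X : SubshiftSpace).carrier}) ∈
      residual ↥MinimalSet := by
    rw [countable_iInter_mem]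
    intro k
    apply residual_of_dense_open
    · rw [isOpen_iff_mem_nhds]
      intro X hX
      obtain ⟨n, hn⟩ := cutProp_open (goodS_of_mem X.1 X.2).inv hX
      refine Filter.mem_of_superset (((isOpen_langEq n (Lang n X.1.carrier)).preimage
        continuous_subtype_val).mem_nhds rfl) ?_
      intro Y hY
      exact hn _ hY
    · rw [dense_iff_inter_open]
      rintro O ⟨V, hV, rfl⟩ ⟨X, hX⟩
      obtain ⟨n, hn⟩ := exists_lang_nhds hV hX
      obtain ⟨Y, hY, hL, hC⟩ := hd X.1 X.2 n k
      exact ⟨⟨Y, hY⟩, hn Y hL, hC⟩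
  refine Filter.mem_of_superset h fun X hX => hT X fun k => ?_
  exact mem_iInter.1 hX k


end Part1

section Part2

/-! ### Part 2: phases and non-conjugacy to the inverse -/

/-- Phase structure: `G` is a set of cut points of period `p`. -/
structure Phase (X G : Set (ℤ → ℤ)) (p : ℕ) : Prop where
  pos : 0 < p
  sub : G ⊆ X
  ex : ∀ x ∈ X, ∃ t : ℤ, 0 ≤ t ∧ t < p ∧ shiftBy t x ∈ G
  uniq : ∀ x ∈ X, ∀ s t : ℤ, 0 ≤ s → s < p → 0 ≤ t → t < p →
    shiftBy s x ∈ G → shiftBy t x ∈ G → s = t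

lemma Phase.of_cut {X E : Set (ℤ → ℤ)} {p : ℕ} (hinv : ∀ x ∈ X, ∀ k : ℤ, shiftBy k x ∈ X)
    (hp : 0 < p)
    (h : ∀ x ∈ X, ∃! t : ℤ, 0 ≤ t ∧ t < p ∧ shiftBy t x ∈ E) : Phase X (X ∩ E) p := by
  refine ⟨hp, inter_subset_left, ?_, ?_⟩
  · intro x hx
    obtain ⟨t, ⟨h0, h1, h2⟩, -⟩ := h x hx
    exact ⟨t, h0, h1, hinv x hx t, h2⟩
  · intro x hx s t hs0 hs1 ht0 ht1 hs ht
    exact (h x hx).unique ⟨hs0, hs1, hs.2⟩ ⟨ht0, ht1, ht.2⟩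

lemma Phase.step {X G : Set (ℤ → ℤ)} {p : ℕ} (h : Phase X G p)
    (hinv : ∀ x ∈ X, ∀ k : ℤ, shiftBy k x ∈ X) {x : ℤ → ℤ} (hx : x ∈ G) :
    shiftBy p x ∈ G := by
  have hX := h.sub hx
  obtain ⟨t, h0, h1, h2⟩ := h.ex (shiftBy 1 x) (hinv x hX 1)
  rw [shiftBy_shiftBy] at h2
  by_cases hlt : t + 1 < p
  · have := h.uniq x hX 0 (t + 1) le_rfl (by have := h.pos; omega) (by omega) hlt
      (by rwa [shiftBy_zero]) h2
    omega
  · have : t + 1 = p := by omega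
    rwa [this] at h2

lemma Phase.step_neg {X G : Set (ℤ → ℤ)} {p : ℕ} (h : Phase X G p)
    (hinv : ∀ x ∈ X, ∀ k : ℤ, shiftBy k x ∈ X) {x : ℤ → ℤ} (hx : x ∈ G) :
    shiftBy (-p) x ∈ G := by
  have hX := h.sub hx
  obtain ⟨t, h0, h1, h2⟩ := h.ex (shiftBy (-p) x) (hinv x hX (-p))
  have h3 := h.step hinv h2
  rw [shiftBy_shiftBy, shiftBy_shiftBy] at h3
  have := h.uniq x hX 0 t le_rfl (by have := h.pos; omega) h0 h1 (by rwa [shiftBy_zero])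
    (by convert h3 using 2; ring)
  subst this
  rwa [shiftBy_zero] at h2

lemma Phase.mul {X G : Set (ℤ → ℤ)} {p : ℕ} (h : Phase X G p)
    (hinv : ∀ x ∈ X, ∀ k : ℤ, shiftBy k x ∈ X) {x : ℤ → ℤ} (hx : x ∈ G) (k : ℤ) :
    shiftBy (k * p) x ∈ G := by
  induction k using Int.induction_on with
  | zero => simpa [shiftBy_zero] using hx
  | succ i ih =>
    have := h.step hinv ih
    rw [shiftBy_shiftBy] at this
    convert this using 2; ring
  | pred i ih =>
    have := h.step_neg hinv ih
    rw [shiftBy_shiftBy] at this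
    convert this using 2; ring

lemma Phase.dvd {X G : Set (ℤ → ℤ)} {p : ℕ} (h : Phase X G p)
    (hinv : ∀ x ∈ X, ∀ k : ℤ, shiftBy k x ∈ X) {x : ℤ → ℤ} (hx : x ∈ G) {j : ℤ}
    (hj : shiftBy j x ∈ G) : (p : ℤ) ∣ j := by
  have hp : (0 : ℤ) < p := by exact_mod_cast h.pos
  have h1 := h.mul hinv hj (-(j / p))
  rw [shiftBy_shiftBy] at h1
  have h2 : -(j / (p : ℤ)) * p + j = j % p := by
    have := Int.emod_add_mul_ediv j p
    linarith
  rw [h2] at h1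
  have := h.uniq x (h.sub hx) 0 (j % p) le_rfl hp (Int.emod_nonneg _ hp.ne')
    (Int.emod_lt_of_pos _ hp) (by rwa [shiftBy_zero]) h1
  exact Int.dvd_of_emod_eq_zero this.symm

lemma Phase.nonempty {X G : Set (ℤ → ℤ)} {p : ℕ} (h : Phase X G p) (hX : X.Nonempty) :
    G.Nonempty := by
  obtain ⟨x, hx⟩ := hX
  obtain ⟨t, -, -, ht⟩ := h.ex x hx
  exact ⟨_, ht⟩

lemma win_of_window {E : Set (ℤ → ℤ)} {N : ℕ}
    (hE : ∀ x y : ℤ → ℤ, (∀ i : ℤ, 0 ≤ i → i < N → x i = y i) → x ∈ E → y ∈ E) : Win E :=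
  ⟨N, fun x y hxy => hE x y fun i h0 h1 => hxy i (by rw [abs_le]; constructor <;> omega)⟩

/-- Infinite subshifts are not determined by one block. -/
lemma Phase.two {X G : Set (ℤ → ℤ)} {p : ℕ} (h : Phase X G p) (hX : GoodS X) :
    ∃ x ∈ G, ∃ y ∈ G, ∃ i : ℤ, 0 ≤ i ∧ i < p ∧ x i ≠ y i := by
  by_contra hcon
  push Not at hcon
  have hp : (0 : ℤ) < p := by exact_mod_cast h.pos
  obtain ⟨g, hg⟩ := h.nonempty hX.ne
  have hall : ∀ x ∈ G, x = g := by
    intro x hx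
    funext i
    have h1 := hcon _ (h.mul hX.inv hx (i / p)) _ (h.mul hX.inv hg (i / p)) (i % p)
      (Int.emod_nonneg _ hp.ne') (Int.emod_lt_of_pos _ hp)
    have h2 : i % (p : ℤ) + i / p * p = i := by
      have := Int.emod_add_mul_ediv i p
      linarith
    simpa [shiftBy, h2] using h1
  apply hX.inf
  apply ((Set.finite_Ico (0 : ℤ) p).image (fun t => shiftBy (-t) g)).subset
  intro x hx
  obtain ⟨t, h0, h1, h2⟩ := h.ex x hx
  refine ⟨t, ⟨h0, h1⟩, ?_⟩
  simp only
  rw [← hall _ h2, shiftBy_shiftBy]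
  simp [shiftBy_zero]

/-- Locally constant functions on compact sets depend on a finite window. -/
lemma exists_radius {X : Set (ℤ → ℤ)} (hX : IsCompact X) {f : ↥X → ℤ} (hf : Continuous f) :
    ∃ r : ℕ, ∀ x y : ↥X, (∀ i : ℤ, |i| ≤ r → x.1 i = y.1 i) → f x = f y := by
  have h1 : ∀ x : ↥X, ∃ M : ℕ, ∀ y : ↥X, y.1 ∈ Cyl x.1 M → f y = f x := by
    intro x
    have ho : IsOpen (f ⁻¹' {f x}) := (isOpen_discrete _).preimage hf
    obtain ⟨V, hV, hV'⟩ := ho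
    have hx : x.1 ∈ V := by
      have : x ∈ f ⁻¹' {f x} := rfl
      rwa [← hV'] at this
    obtain ⟨M, hM⟩ := exists_cyl_subset hV hx
    refine ⟨M, fun y hy => ?_⟩
    have : y ∈ Subtype.val ⁻¹' V := hM hy
    rw [hV'] at this
    exact this
  choose M hM using h1
  obtain ⟨t, ht⟩ := hX.elim_finite_subcover (fun x : ↥X => Cyl x.1 (M x))
    (fun x => isOpen_cyl _ _) (fun x hx => mem_iUnion.2 ⟨⟨x, hx⟩, fun i _ => rfl⟩)
  refine ⟨t.sup M, fun x y hxy => ?_⟩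
  have := ht x.2
  simp only [mem_iUnion, exists_prop] at this
  obtain ⟨z, hz, hxz⟩ := this
  have hle : M z ≤ t.sup M := Finset.le_sup hz
  rw [hM z x hxz, hM z y]
  intro i hi
  rw [← hxy i (hi.trans (by exact_mod_cast hle))]
  exact hxz i hi

lemma not_conj_inv {X : Set (ℤ → ℤ)} (hX : GoodS X) (hC : ∀ k, CutProp k X) :
    ¬ ConjugateBy X X shift shiftInv := by
  rintro ⟨φ, hφ⟩
  have hs : ∀ (k : ℤ) (x : ℤ → ℤ) (hx : x ∈ X),
      (φ ⟨shiftBy k x, hX.inv x hx k⟩).1 = shiftBy (-k) (φ ⟨x, hx⟩).1 := by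
    intro k
    induction k using Int.induction_on with
    | zero =>
      intro x hx
      simp [shiftBy_zero]
    | succ i ih =>
      intro x hx
      have h1 := hφ (shiftBy i x) (hX.inv x hx i) (by
        rw [shift_eq]; exact hX.inv _ (hX.inv x hx i) 1)
      have h2 : shift (shiftBy (i : ℤ) x) = shiftBy (i + 1) x := by
        rw [shift_eq, shiftBy_shiftBy, add_comm]
      have h3 : shiftInv (shiftBy (-(i : ℤ)) (φ ⟨x, hx⟩).1) =
          shiftBy (-((i : ℤ) + 1)) (φ ⟨x, hx⟩).1 := by
        funext j; simp only [shiftInv, shiftBy]; ring_nf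
      rw [ih x hx, h3] at h1
      rw [← h1]
      simp only [h2]
    | pred i ih =>
      intro x hx
      have h1 := hφ (shiftBy (-i - 1) x) (hX.inv x hx _) (by
        rw [shift_eq]; exact hX.inv _ (hX.inv x hx _) 1)
      have h2 : shift (shiftBy (-(i : ℤ) - 1) x) = shiftBy (-i) x := by
        rw [shift_eq, shiftBy_shiftBy]; congr 1; ring
      simp only [h2] at h1
      rw [ih x hx] at h1
      funext j
      have := congrFun h1 (j + 1)
      simp only [shiftInv, shiftBy] at this ⊢
      rw [add_sub_cancel_right] at this
      rw [← this]; ring_nf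
  obtain ⟨r, hr⟩ := exists_radius (f := fun x => (φ x).1 0) hX.cpt
    ((continuous_apply 0).comp (continuous_subtype_val.comp φ.continuous))
  have hr' : ∀ (x y : ↥X) (i : ℤ), (∀ j : ℤ, |j + i| ≤ r → x.1 j = y.1 j) →
      (φ x).1 i = (φ y).1 i := by
    intro x y i hxy
    have h1 := hr ⟨shiftBy (-i) x.1, hX.inv _ x.2 _⟩ ⟨shiftBy (-i) y.1, hX.inv _ y.2 _⟩ (by
      intro j hj
      exact hxy _ (by simpa using hj))
    have h2 := hs (-i) x.1 x.2
    have h3 := hs (-i) y.1 y.2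
    simp only [h2, h3] at h1
    simpa [shiftBy] using h1
  obtain ⟨p, N, E, u, v, hp, -, hE, hcut, huv, -, -, hasym⟩ := hC r
  have hP : Phase X (X ∩ E) p := Phase.of_cut hX.inv hp hcut
  have hpz : (0 : ℤ) < p := by exact_mod_cast hp
  have hW : Win E := win_of_window hE
  obtain ⟨x0, hx0⟩ := hP.nonempty hX.ne
  obtain ⟨t, ht0, ht1, ht⟩ := hP.ex (φ ⟨x0, hx0.1⟩).1 (φ ⟨x0, hx0.1⟩).2
  have hA : ∀ (x : ℤ → ℤ) (hx : x ∈ X), x ∈ E → shiftBy t (φ ⟨x, hx⟩).1 ∈ X ∩ E := by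
    intro x hx hxE
    refine ⟨hX.inv _ (φ ⟨x, hx⟩).2 t, ?_⟩
    by_contra hcon
    have hO : IsOpen ({z : ↥X | z.1 ∈ E ∧ (φ z).1 ∈ {w | shiftBy t w ∈ E}ᶜ}) :=
      (hW.isOpen.preimage continuous_subtype_val).inter
        ((hW.shift t).compl.isOpen.preimage (continuous_subtype_val.comp φ.continuous))
    obtain ⟨V, hV, hVe⟩ := hO
    have hxV : x ∈ V := by
      have : (⟨x, hx⟩ : ↥X) ∈ Subtype.val ⁻¹' V := by rw [hVe]; exact ⟨hxE, hcon⟩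
      exact this
    obtain ⟨j, hj⟩ := hX.visit hx0.1 hx hV hxV
    have hj2 : (⟨shiftBy j x0, hX.inv _ hx0.1 j⟩ : ↥X) ∈ Subtype.val ⁻¹' V := hj
    rw [hVe] at hj2
    obtain ⟨hj3, hj4⟩ := hj2
    have hd := hP.dvd hX.inv hx0 (j := j) ⟨hX.inv _ hx0.1 j, hj3⟩
    obtain ⟨q, rfl⟩ := hd
    apply hj4
    rw [hs _ x0 hx0.1]
    have := (hP.mul hX.inv ht (-q)).2
    rw [shiftBy_shiftBy] at this
    simp only [mem_ofPred_eq, shiftBy_shiftBy]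
    convert this using 2; ring
  have hB : ∀ (x : ↥X), shiftBy t (φ x).1 ∈ E → x.1 ∈ E := by
    rintro ⟨x, hx⟩ hxt
    obtain ⟨s, hs0, hs1, hs2⟩ := hP.ex x hx
    have h1 := hA _ (hX.inv x hx s) hs2.2
    rw [hs, shiftBy_shiftBy] at h1
    have h2 := hP.dvd hX.inv (x := shiftBy t (φ ⟨x, hx⟩).1) (j := -s)
      ⟨hX.inv _ (φ ⟨x, hx⟩).2 t, hxt⟩ (by rw [shiftBy_shiftBy]; rwa [add_comm])
    have h3 : s = 0 := by
      obtain ⟨q, hq⟩ := h2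
      have : -s = p * q := hq
      rcases lt_trichotomy q 0 with h | h | h
      · nlinarith
      · subst h; linarith
      · nlinarith
    subst h3
    rw [shiftBy_zero] at hs2
    exact hs2.2
  apply hasym
  refine ⟨-t, fun h h0 h1 hne => ?_⟩
  -- two points of the cut set differing at `h`
  obtain ⟨y1, hy1, y2, hy2, hy⟩ : ∃ y1 ∈ X ∩ E, ∃ y2 ∈ X ∩ E, y1 h ≠ y2 h := by
    obtain ⟨a, ha, b, hb, i, hi0, hi1, hab⟩ := hP.two hX
    rcases huv a ha.1 ha.2 with ha' | ha' <;> rcases huv b hb.1 hb.2 with hb' | hb'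
    · exact absurd ((ha' i hi0 hi1).trans (hb' i hi0 hi1).symm) hab
    · exact ⟨a, ha, b, hb, by rw [ha' h h0 h1, hb' h h0 h1]; exact hne⟩
    · exact ⟨a, ha, b, hb, by rw [ha' h h0 h1, hb' h h0 h1]; exact hne.symm⟩
    · exact absurd ((ha' i hi0 hi1).trans (hb' i hi0 hi1).symm) hab
  set x1 := φ.symm ⟨shiftBy (-t) y1, hX.inv _ hy1.1 _⟩ with hx1
  set x2 := φ.symm ⟨shiftBy (-t) y2, hX.inv _ hy2.1 _⟩ with hx2
  have e1 : (φ x1).1 = shiftBy (-t) y1 := by rw [hx1, φ.apply_symm_apply]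
  have e2 : (φ x2).1 = shiftBy (-t) y2 := by rw [hx2, φ.apply_symm_apply]
  have m1 : x1.1 ∈ X ∩ E := ⟨x1.2, hB x1 (by
    rw [e1, shiftBy_shiftBy]; simpa [shiftBy_zero] using hy1.2)⟩
  have m2 : x2.1 ∈ X ∩ E := ⟨x2.2, hB x2 (by
    rw [e2, shiftBy_shiftBy]; simpa [shiftBy_zero] using hy2.2)⟩
  have hdiff : ∃ j : ℤ, |j + (h + t)| ≤ r ∧ x1.1 j ≠ x2.1 j := by
    by_contra hcon
    push Not at hcon
    have := hr' x1 x2 (h + t) hcon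
    rw [e1, e2] at this
    simp only [shiftBy, add_neg_cancel_right] at this
    exact hy this
  obtain ⟨j, hj, hjne⟩ := hdiff
  have hdec : j % (p : ℤ) + j / p * p = j := by
    have := Int.emod_add_mul_ediv j p
    linarith
  have hj0 := Int.emod_nonneg j hpz.ne'
  have hj1 := Int.emod_lt_of_pos j hpz
  refine ⟨j % p, -(j / p), hj0, hj1, ?_, ?_⟩
  · have n1 := hP.mul hX.inv m1 (j / p)
    have n2 := hP.mul hX.inv m2 (j / p)
    have v1 : shiftBy (j / (p : ℤ) * p) x1.1 (j % p) = x1.1 j := by simp [shiftBy, hdec]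
    have v2 : shiftBy (j / (p : ℤ) * p) x2.1 (j % p) = x2.1 j := by simp [shiftBy, hdec]
    rcases huv _ n1.1 n1.2 with k1 | k1 <;> rcases huv _ n2.1 n2.2 with k2 | k2 <;>
      have k1 := k1 _ hj0 hj1 <;> have k2 := k2 _ hj0 hj1 <;> rw [v1] at k1 <;> rw [v2] at k2
    · exact absurd (k1.trans k2.symm) hjne
    · rw [← k1, ← k2]; exact hjne
    · rw [← k1, ← k2]; exact hjne.symm
    · exact absurd (k1.trans k2.symm) hjne
  · convert hj using 2
    linarith


end Part2

section Part3

/-! ### Part 3: towers of cuts -/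

structure Tower (X : Set (ℤ → ℤ)) (G : ℕ → Set (ℤ → ℤ)) (p : ℕ → ℕ) : Prop where
  good : GoodS X
  phase : ∀ n, Phase X (G n) (p n)
  zero : G 0 = X
  pzero : p 0 = 1
  sub : ∀ n, G (n + 1) ⊆ G n
  lt : ∀ n, p n < p (n + 1)
  win : ∀ n, ∃ E, Win E ∧ G n = X ∩ E
  two : ∀ n, ∃ u v : ℤ → ℤ, ∀ x ∈ G (n + 1), (∀ i : ℤ, 0 ≤ i → i < p (n + 1) → x i = u i) ∨
    (∀ i : ℤ, 0 ≤ i → i < p (n + 1) → x i = v i)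
  prim : ∀ n, ∀ x ∈ G (n + 1), ∀ y ∈ G n, ∃ i : ℤ, 0 ≤ i ∧ (i + 1) * p n ≤ p (n + 1) ∧
    ∀ j : ℤ, 0 ≤ j → j < p n → x (i * p n + j) = y j
  proper : ∀ n, ∀ x ∈ G (n + 1), ∀ y ∈ G (n + 1), ∀ i : ℤ, -(p n : ℤ) ≤ i → i < p n → x i = y i

lemma tower_step {X : Set (ℤ → ℤ)} (hX : GoodS X) (hC : ∀ k, CutProp k X)
    {G : Set (ℤ → ℤ)} {p : ℕ} (hP : Phase X G p) (hG : ∃ E, Win E ∧ G = X ∩ E) :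
    ∃ (G' : Set (ℤ → ℤ)) (p' : ℕ), Phase X G' p' ∧ (∃ E, Win E ∧ G' = X ∩ E) ∧ G' ⊆ G ∧ p < p' ∧
      (∃ u v : ℤ → ℤ, ∀ x ∈ G', (∀ i : ℤ, 0 ≤ i → i < p' → x i = u i) ∨
        (∀ i : ℤ, 0 ≤ i → i < p' → x i = v i)) ∧
      (∀ x ∈ G', ∀ y ∈ G, ∃ i : ℤ, 0 ≤ i ∧ (i + 1) * p ≤ p' ∧
        ∀ j : ℤ, 0 ≤ j → j < p → x (i * p + j) = y j) ∧
      (∀ x ∈ G', ∀ y ∈ G', ∀ i : ℤ, -(p : ℤ) ≤ i → i < p → x i = y i) := by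
  obtain ⟨E, hE, rfl⟩ := hG
  have hpz : (0 : ℤ) < p := by exact_mod_cast hP.pos
  -- uniform recurrence bound
  obtain ⟨R, hR⟩ : ∃ R : ℕ, ∀ x ∈ X, ∀ y ∈ X ∩ E, ∃ i : ℤ, 0 ≤ i ∧ i < R ∧
      shiftBy i x ∈ E ∧ ∀ j : ℤ, 0 ≤ j → j < p → x (i + j) = y j := by
    set O : (ℤ → ℤ) → Set (ℤ → ℤ) := fun y => E ∩ {x | ∀ j, 0 ≤ j → j < (p : ℤ) → x j = y j}
      with hOdef
    have hO : ∀ y, IsOpen (O y) := fun y => (hE.inter (win_eq 0 p y)).isOpen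
    have h1 : ∀ y : ↥(X ∩ E), ∃ R : ℕ, ∀ x ∈ X, ∃ i : ℤ, 0 ≤ i ∧ i < R ∧ shiftBy i x ∈ O y.1 :=
      fun y => hX.synd y.2.1 (hO y.1) ⟨y.2.2, fun j _ _ => rfl⟩
    choose R hR using h1
    obtain ⟨t, ht⟩ := (hX.cpt.inter_right hE.isClosed).elim_finite_subcover
      (fun y : ↥(X ∩ E) => O y.1) (fun y => hO y.1)
      (fun y hy => mem_iUnion.2 ⟨⟨y, hy⟩, hy.2, fun j _ _ => rfl⟩)
    refine ⟨t.sup R, fun x hx y hy => ?_⟩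
    have := ht hy
    simp only [mem_iUnion, exists_prop] at this
    obtain ⟨z, hz, hyz⟩ := this
    obtain ⟨i, h0, h1, h2⟩ := hR z x hx
    have hle : R z ≤ t.sup R := Finset.le_sup hz
    refine ⟨i, h0, by omega, h2.1, fun j hj0 hj1 => ?_⟩
    rw [hyz.2 j hj0 hj1, ← h2.2 j hj0 hj1]
    simp [shiftBy, add_comm]
  set k := 3 * p + R + 1 with hk
  obtain ⟨p', N, E', u, v, hp', hq, hE', hcut, huv, hpre, hsuf, -⟩ := hC k
  have hkp : k ≤ p' := Nat.le_of_dvd hp' (hq k (by omega) le_rfl)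
  have hpp : p ∣ p' := hq p hP.pos (by omega)
  have hW' : Win E' := win_of_window hE'
  have hP' : Phase X (X ∩ E') p' := Phase.of_cut hX.inv hp' hcut
  obtain ⟨y0, hy0⟩ := hP'.nonempty hX.ne
  obtain ⟨o, ho0, ho1, ho⟩ := hP.ex y0 hy0.1
  -- all cut points are aligned
  have hal : ∀ y ∈ X ∩ E', shiftBy o y ∈ X ∩ E := by
    intro y hy
    refine ⟨hX.inv _ hy.1 _, ?_⟩
    by_contra hcon
    have hO : IsOpen (E' ∩ {z | shiftBy o z ∈ E}ᶜ) := (hW'.inter (hE.shift o).compl).isOpen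
    obtain ⟨j, hj1, hj2⟩ := hX.visit hy0.1 hy.1 hO ⟨hy.2, hcon⟩
    obtain ⟨q, rfl⟩ := hP'.dvd hX.inv hy0 (j := j) ⟨hX.inv _ hy0.1 _, hj1⟩
    obtain ⟨m, rfl⟩ := hpp
    apply hj2
    have := (hP.mul hX.inv ho (m * q)).2
    rw [shiftBy_shiftBy] at this
    show shiftBy o (shiftBy _ y0) ∈ E
    rw [shiftBy_shiftBy]
    convert this using 2; push_cast; ring
  -- values near the cut points
  have hnear : ∀ x ∈ X ∩ E', ∀ y ∈ X ∩ E', ∀ i : ℤ, -(k : ℤ) ≤ i → i < k → x i = y i := by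
    intro x hx y hy i hi0 hi1
    by_cases hi : 0 ≤ i
    · have e := hpre i hi hi1
      have hip : i < p' := by omega
      rcases huv x hx.1 hx.2 with h | h <;> rcases huv y hy.1 hy.2 with h' | h' <;>
        rw [h i hi hip, h' i hi hip] <;> simp [e]
    · have hx' := hP'.step_neg hX.inv hx
      have hy' := hP'.step_neg hX.inv hy
      have a0 : 0 ≤ i + p' := by omega
      have a1 : i + p' < p' := by omega
      have e := hsuf (i + p') (by omega) a1
      have ex : shiftBy (-(p' : ℤ)) x (i + p') = x i := by simp [shiftBy]
      have ey : shiftBy (-(p' : ℤ)) y (i + p') = y i := by simp [shiftBy]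
      rw [← ex, ← ey]
      rcases huv _ hx'.1 hx'.2 with h | h <;> rcases huv _ hy'.1 hy'.2 with h' | h' <;>
        rw [h _ a0 a1, h' _ a0 a1] <;> simp [e]
  have hback : ∀ (x : ℤ → ℤ) (i : ℤ), x i = shiftBy (-o) x (i + o) := by
    intro x i; simp [shiftBy]
  refine ⟨X ∩ {x | shiftBy (-o) x ∈ E'}, p', ⟨hp', inter_subset_left, ?_, ?_⟩,
    ⟨_, hW'.shift (-o), rfl⟩, ?_, by omega, ?_, ?_, ?_⟩
  · intro x hx
    obtain ⟨t, h0, h1, h2⟩ := hP'.ex _ (hX.inv x hx (-o))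
    refine ⟨t, h0, h1, hX.inv x hx t, ?_⟩
    show shiftBy (-o) (shiftBy t x) ∈ E'
    have := h2.2
    rw [shiftBy_shiftBy] at this ⊢
    rwa [add_comm]
  · intro x hx s t hs0 hs1 ht0 ht1 hs ht
    refine hP'.uniq _ (hX.inv x hx (-o)) s t hs0 hs1 ht0 ht1 ?_ ?_
    · have := hs.2
      refine ⟨hX.inv _ (hX.inv _ hx _) _, ?_⟩
      rw [shiftBy_shiftBy, add_comm, ← shiftBy_shiftBy]; exact this
    · have := ht.2
      refine ⟨hX.inv _ (hX.inv _ hx _) _, ?_⟩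
      rw [shiftBy_shiftBy, add_comm, ← shiftBy_shiftBy]; exact this
  · intro x hx
    have := hal _ ⟨hX.inv x hx.1 (-o), hx.2⟩
    rw [shiftBy_shiftBy] at this
    simpa [shiftBy_zero] using this
  · refine ⟨fun i => if i + o < p' then u (i + o) else u (i + o - p'),
      fun i => if i + o < p' then v (i + o) else v (i + o - p'), fun x hx => ?_⟩
    have hy : shiftBy (-o) x ∈ X ∩ E' := ⟨hX.inv x hx.1 (-o), hx.2⟩
    have hy' := hP'.step hX.inv hy
    have htail : ∀ i : ℤ, i < p' → ¬ (i + o < p') →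
        x i = u (i + o - p') ∧ x i = v (i + o - p') := by
      intro i hi1 hi2
      have a0 : 0 ≤ i + o - p' := by omega
      have a1 : i + o - p' < p' := by omega
      have e := hpre (i + o - p') a0 (by omega)
      have ev : shiftBy p' (shiftBy (-o) x) (i + o - p') = x i := by simp [shiftBy]
      rcases huv _ hy'.1 hy'.2 with h | h
      · have := h _ a0 a1
        rw [ev] at this
        exact ⟨this, this.trans e⟩
      · have := h _ a0 a1
        rw [ev] at this
        exact ⟨this.trans e.symm, this⟩
    rcases huv _ hy.1 hy.2 with h | h
    · refine Or.inl fun i hi0 hi1 => ?_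
      by_cases hi : i + o < p'
      · simp only [hi, if_true]; rw [hback x i]; exact h _ (by omega) hi
      · simp only [hi, if_false]; exact (htail i hi1 hi).1
    · refine Or.inr fun i hi0 hi1 => ?_
      by_cases hi : i + o < p'
      · simp only [hi, if_true]; rw [hback x i]; exact h _ (by omega) hi
      · simp only [hi, if_false]; exact (htail i hi1 hi).2
  · intro x hx y hy
    have hxG : x ∈ X ∩ E := by
      have := hal _ ⟨hX.inv x hx.1 (-o), hx.2⟩
      rw [shiftBy_shiftBy] at this
      simpa [shiftBy_zero] using this
    obtain ⟨i, hi0, hi1, hi2, hi3⟩ := hR x hx.1 y hy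
    obtain ⟨m, rfl⟩ := hP.dvd hX.inv hxG (j := i) ⟨hX.inv _ hx.1 _, hi2⟩
    refine ⟨m, by nlinarith, ?_, fun j h0 h1 => ?_⟩
    · have : (m + 1) * (p : ℤ) = p * m + p := by ring
      rw [this]; omega
    · rw [mul_comm]; exact hi3 j h0 h1
  · intro x hx y hy i hi0 hi1
    rw [hback x i, hback y i]
    exact hnear _ ⟨hX.inv x hx.1 (-o), hx.2⟩ _ ⟨hX.inv y hy.1 (-o), hy.2⟩ _ (by omega) (by omega)

lemma exists_tower {X : Set (ℤ → ℤ)} (hX : GoodS X) (hC : ∀ k, CutProp k X) :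
    ∃ G p, Tower X G p := by
  let St := {s : Set (ℤ → ℤ) × ℕ // Phase X s.1 s.2 ∧ ∃ E, Win E ∧ s.1 = X ∩ E}
  have hstep : ∀ s : St, ∃ s' : St, s'.1.1 ⊆ s.1.1 ∧ s.1.2 < s'.1.2 ∧
      (∃ u v : ℤ → ℤ, ∀ x ∈ s'.1.1, (∀ i : ℤ, 0 ≤ i → i < s'.1.2 → x i = u i) ∨
        (∀ i : ℤ, 0 ≤ i → i < s'.1.2 → x i = v i)) ∧
      (∀ x ∈ s'.1.1, ∀ y ∈ s.1.1, ∃ i : ℤ, 0 ≤ i ∧ (i + 1) * s.1.2 ≤ s'.1.2 ∧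
        ∀ j : ℤ, 0 ≤ j → j < s.1.2 → x (i * s.1.2 + j) = y j) ∧
      (∀ x ∈ s'.1.1, ∀ y ∈ s'.1.1, ∀ i : ℤ, -(s.1.2 : ℤ) ≤ i → i < s.1.2 → x i = y i) := by
    rintro ⟨⟨G, p⟩, hP, hG⟩
    obtain ⟨G', p', h1, h2, h3⟩ := tower_step hX hC hP hG
    exact ⟨⟨⟨G', p'⟩, h1, h2⟩, h3⟩
  choose nxt hn using hstep
  let s0 : St := ⟨⟨X, 1⟩, ⟨one_pos, subset_rfl, fun x hx => ⟨0, le_rfl, by simp, hX.inv x hx 0⟩,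
    fun x hx s t a b c d _ _ => by push_cast at b d; omega⟩, univ, ⟨0, fun _ _ _ _ => trivial⟩, by simp⟩
  let f : ℕ → St := fun n => Nat.rec s0 (fun _ s => nxt s) n
  refine ⟨fun n => (f n).1.1, fun n => (f n).1.2, hX, fun n => (f n).2.1, rfl, rfl, ?_, ?_,
    fun n => (f n).2.2, ?_, ?_, ?_⟩
  · exact fun n => (hn (f n)).1
  · exact fun n => (hn (f n)).2.1
  · exact fun n => (hn (f n)).2.2.1
  · exact fun n => (hn (f n)).2.2.2.1
  · exact fun n => (hn (f n)).2.2.2.2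


end Part3

section Part4

/-! ### Part 4: from towers to directive sequences -/

section words
variable {A : Type*}

lemma factorAt_append (y : ℤ → A) (i : ℤ) (a b : ℕ) :
    factorAt y i (a + b) = factorAt y i a ++ factorAt y (i + a) b := by
  simp only [factorAt_eq, List.range_add, List.map_append, List.map_map]
  congr 1
  apply List.map_congr_left
  intro j _
  simp [add_assoc]

lemma flatMap_factorAt (y : ℤ → A) (q Q : ℕ) :
    (List.range q).flatMap (fun j : ℕ => factorAt y ((j : ℤ) * Q) Q) = factorAt y 0 (q * Q) := by
  induction q with
  | zero => simp [factorAt_eq]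
  | succ q ih =>
    rw [List.range_succ, List.flatMap_append, ih, Nat.succ_mul, factorAt_append]
    simp

lemma factorAt_infix (y : ℤ → A) {i : ℤ} {m L : ℕ} (h0 : 0 ≤ i) (h1 : i + m ≤ L) :
    (factorAt y i m).IsInfix (factorAt y 0 L) := by
  obtain ⟨a, rfl⟩ := Int.eq_ofNat_of_zero_le h0
  obtain ⟨b, rfl⟩ : ∃ b, L = a + m + b := ⟨L - (a + m), by omega⟩
  refine ⟨factorAt y 0 a, factorAt y (0 + ((a + m : ℕ) : ℤ)) b, ?_⟩
  rw [factorAt_append, factorAt_append, zero_add, zero_add]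

lemma exists_of_infix {y : ℤ → A} {w : List A} {L : ℕ} (h : w.IsInfix (factorAt y 0 L)) :
    ∃ i : ℤ, w = factorAt y i w.length := by
  obtain ⟨s, t, h⟩ := h
  refine ⟨s.length, ?_⟩
  have hl : s.length + w.length + t.length = L := by
    have := congrArg List.length h
    simpa [factorAt_length, add_assoc] using this
  rw [← hl, factorAt_append, factorAt_append] at h
  have h1 := (List.append_inj' h (by simp [factorAt_length])).1
  have h2 := (List.append_inj' h1 (by simp [factorAt_length])).2
  simpa using h2

lemma mem_factorAt (y : ℤ → A) {j : ℤ} {L : ℕ} (h0 : 0 ≤ j) (h1 : j < L) :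
    y j ∈ factorAt y 0 L := by
  rw [factorAt_eq, List.mem_map]
  exact ⟨j.toNat, by rw [List.mem_range]; omega, by simp [Int.toNat_of_nonneg h0]⟩

end words

variable {X : Set (ℤ → ℤ)} {G : ℕ → Set (ℤ → ℤ)} {p : ℕ → ℕ}

/-- The alphabet of level `n`. -/
def TB (G : ℕ → Set (ℤ → ℤ)) (p : ℕ → ℕ) (n : ℕ) : Type :=
  {w : List ℤ // ∃ x ∈ G n, w = factorAt x 0 (p n)}

def lam (G : ℕ → Set (ℤ → ℤ)) (p : ℕ → ℕ) (n : ℕ) (x : ↥(G n)) : TB G p n :=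
  ⟨factorAt x.1 0 (p n), x.1, x.2, rfl⟩

lemma lam_surj (n : ℕ) (w : TB G p n) : ∃ x : ↥(G n), lam G p n x = w := by
  obtain ⟨w, x, hx, rfl⟩ := w
  exact ⟨⟨x, hx⟩, rfl⟩

lemma lam_eq_iff {n : ℕ} {x y : ↥(G n)} :
    lam G p n x = lam G p n y ↔ ∀ t : ℤ, 0 ≤ t → t < p n → x.1 t = y.1 t := by
  have h : lam G p n x = lam G p n y ↔ factorAt x.1 0 (p n) = factorAt y.1 0 (p n) :=
    ⟨fun h => congrArg Subtype.val h, fun h => Subtype.ext h⟩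
  rw [h, factorAt_ext]
  simp

namespace Tower

def sh (T : Tower X G p) (n : ℕ) (x : ↥(G n)) (j : ℤ) : ↥(G n) :=
  ⟨shiftBy (j * p n) x.1, (T.phase n).mul T.good.inv x.2 j⟩

def cod (T : Tower X G p) (n : ℕ) (x : ↥(G n)) : ℤ → TB G p n := fun j => lam G p n (T.sh n x j)

lemma cod_eq_iff (T : Tower X G p) {n : ℕ} {x y : ↥(G n)} {i j : ℤ} :
    T.cod n x i = T.cod n y j ↔
      ∀ t : ℤ, 0 ≤ t → t < p n → x.1 (i * p n + t) = y.1 (j * p n + t) := by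
  unfold cod
  rw [lam_eq_iff]
  simp [sh, shiftBy, add_comm]

lemma cod_sh (T : Tower X G p) (n : ℕ) (x : ↥(G n)) (i j : ℤ) :
    T.cod n (T.sh n x j) i = T.cod n x (i + j) := by
  rw [cod_eq_iff]
  intro t _ _
  simp only [sh, shiftBy]
  ring_nf

lemma sub_add (T : Tower X G p) (n k : ℕ) : G (n + k) ⊆ G n := by
  induction k with
  | zero => exact subset_rfl
  | succ k ih => exact (T.sub (n + k)).trans ih

lemma pos (T : Tower X G p) (n : ℕ) : 0 < p n := (T.phase n).pos

lemma posz (T : Tower X G p) (n : ℕ) : (0 : ℤ) < p n := by exact_mod_cast T.pos n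

lemma dvd (T : Tower X G p) (n : ℕ) : p n ∣ p (n + 1) := by
  obtain ⟨x, hx⟩ := (T.phase (n + 1)).nonempty T.good.ne
  have h1 := (T.phase (n + 1)).step T.good.inv hx
  exact_mod_cast (T.phase n).dvd T.good.inv (T.sub n hx) (T.sub n h1)

lemma dvd_add (T : Tower X G p) (n k : ℕ) : p n ∣ p (n + k) := by
  induction k with
  | zero => exact dvd_rfl
  | succ k ih => exact ih.trans (T.dvd (n + k))

lemma le_p (T : Tower X G p) (n k : ℕ) : k ≤ p (n + k) := by
  induction k with
  | zero => simp
  | succ k ih => have := T.lt (n + k); rw [← add_assoc]; omega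

lemma cod_inj (T : Tower X G p) (n : ℕ) {x y : ↥(G n)} (h : T.cod n x = T.cod n y) : x = y := by
  apply Subtype.ext
  funext i
  have hp := T.posz n
  have := T.cod_eq_iff.1 (congrFun h (i / p n)) (i % p n) (Int.emod_nonneg _ hp.ne')
    (Int.emod_lt_of_pos _ hp)
  have e : i / (p n : ℤ) * p n + i % p n = i := Int.ediv_mul_add_emod i (p n)
  rwa [e] at this

def down (T : Tower X G p) (n k : ℕ) (x : ↥(G (n + k))) : ↥(G n) := ⟨x.1, T.sub_add n k x.2⟩

noncomputable def rep (_ : Tower X G p) (n : ℕ) (w : TB G p n) : ↥(G n) := (lam_surj n w).choose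

lemma lam_rep (T : Tower X G p) (n : ℕ) (w : TB G p n) : lam G p n (T.rep n w) = w :=
  (lam_surj n w).choose_spec

/-- The directive sequence. -/
noncomputable def sig (T : Tower X G p) (n : ℕ) (w : TB G p (n + 1)) : List (TB G p n) :=
  factorAt (T.cod n (T.down n 1 (T.rep (n + 1) w))) 0 (p (n + 1) / p n)

lemma block_le (T : Tower X G p) (n k : ℕ) {i t : ℤ}
    (hi : i < (p (n + k) / p n : ℕ)) (ht : t < p n) : i * p n + t < p (n + k) := by
  obtain ⟨m, hm⟩ := T.dvd_add n k
  have hp := T.pos n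
  rw [hm, Nat.mul_div_cancel_left _ hp] at hi
  rw [hm]
  push_cast
  have : (i + 1) * (p n : ℤ) ≤ m * p n := by
    apply mul_le_mul_of_nonneg_right _ (T.posz n).le
    omega
  nlinarith

lemma sig_lam (T : Tower X G p) (n : ℕ) (x : ↥(G (n + 1))) :
    T.sig n (lam G p (n + 1) x) = factorAt (T.cod n (T.down n 1 x)) 0 (p (n + 1) / p n) := by
  unfold sig
  rw [factorAt_ext]
  intro i hi0 hi1
  rw [cod_eq_iff]
  intro t ht0 ht1
  have h := lam_eq_iff.1 (T.lam_rep (n + 1) (lam G p (n + 1) x))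
  have := T.posz n
  apply h
  · rw [zero_add]; positivity
  · rw [zero_add]; exact T.block_le n 1 hi1 ht1

lemma aux_lam (T : Tower X G p) (n k : ℕ) (x : ↥(G (n + k))) :
    sadicWordAux T.sig n k (lam G p (n + k) x) =
      factorAt (T.cod n (T.down n k x)) 0 (p (n + k) / p n) := by
  induction k with
  | zero =>
    have : p (n + 0) / p n = 1 := Nat.div_self (T.pos n)
    rw [this]
    simp only [sadicWordAux, factorAt_eq, List.range_one, List.map_cons, List.map_nil]
    congr 1
    simp only [cod]
    symm
    refine (lam_eq_iff (G := G) (p := p) (n := n)).2 ?_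
    intro t _ _
    simp [sh, down, shiftBy]
  | succ k ih =>
    show (T.sig (n + k) (lam G p (n + k + 1) x)).flatMap (sadicWordAux T.sig n k) = _
    rw [sig_lam, factorAt_eq, List.flatMap_map]
    have h1 : ∀ j : ℕ, sadicWordAux T.sig n k (T.cod (n + k) (T.down (n + k) 1 x) (0 + (j : ℤ))) =
        factorAt (T.cod n (T.down n (k + 1) x)) ((j : ℤ) * (p (n + k) / p n : ℕ))
          (p (n + k) / p n) := by
      intro j
      unfold cod
      rw [ih, factorAt_ext]
      intro t _ _
      change T.cod _ _ _ = T.cod _ _ _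
      rw [cod_eq_iff]
      intro s _ _
      obtain ⟨m, hm⟩ := T.dvd_add n k
      simp only [down, sh, shiftBy]
      rw [hm, Nat.mul_div_cancel_left _ (T.pos n)]
      push_cast
      ring_nf
    have h2 : (fun j : ℕ => sadicWordAux T.sig n k
        (T.cod (n + k) (T.down (n + k) 1 x) (0 + (j : ℤ)))) = fun j : ℕ =>
        factorAt (T.cod n (T.down n (k + 1) x)) ((j : ℤ) * (p (n + k) / p n : ℕ))
          (p (n + k) / p n) := funext h1
    rw [h2, flatMap_factorAt]
    congr 1
    have hd := T.dvd_add n k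
    have hd' := T.dvd (n + k)
    rw [Nat.div_mul_div_comm hd' hd]
    show _ = p (n + k + 1) / p n
    have := T.pos (n + k)
    rw [mul_comm, Nat.mul_div_mul_left _ _ this]

lemma closed (T : Tower X G p) (n : ℕ) : IsCompact (G n) := by
  obtain ⟨E, hE, h⟩ := T.win n
  rw [h]
  exact T.good.cpt.inter_right hE.isClosed

lemma xlevel (T : Tower X G p) (n : ℕ) : XLevel T.sig n = range (T.cod n) := by
  obtain ⟨E, hE, hGE⟩ := T.win n
  ext y
  constructor
  · intro hy
    -- approximate by points of `G n`
    have happ : ∀ m : ℕ, ∃ x : ↥(G n), ∀ j : ℤ, |j| ≤ m → T.cod n x j = y j := by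
      intro m
      obtain ⟨k, -, a, ha⟩ := hy (-m) (2 * m + 1)
      obtain ⟨x, rfl⟩ := lam_surj (n + k) a
      rw [aux_lam] at ha
      obtain ⟨i, hi⟩ := exists_of_infix ha
      rw [factorAt_length, factorAt_ext] at hi
      refine ⟨T.sh n (T.down n k x) (i + m), fun j hj => ?_⟩
      rw [abs_le] at hj
      rw [cod_sh]
      have := hi (j + m) (by omega) (by push_cast; omega)
      rw [show (-(m : ℤ) + (j + m)) = j by ring] at this
      rw [this]
      congr 1; ring
    choose f hf using happ
    have hne : (⋂ m : ℕ, {x : ℤ → ℤ | x ∈ G n ∧ ∀ (hx : x ∈ G n) (j : ℤ), |j| ≤ m →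
        T.cod n ⟨x, hx⟩ j = y j}).Nonempty := by
      have key : ∀ m : ℕ, {x : ℤ → ℤ | x ∈ G n ∧ ∀ (hx : x ∈ G n) (j : ℤ), |j| ≤ m →
          T.cod n ⟨x, hx⟩ j = y j} =
          G n ∩ {x | ∀ i : ℤ, -(m : ℤ) * p n ≤ i → i < (m + 1 : ℤ) * p n → x i = (f m).1 i} := by
        intro m
        have hp := T.posz n
        ext x
        simp only [mem_ofPred_eq, mem_inter_iff]
        refine and_congr_right fun hx => ?_
        have e1 : ∀ j : ℤ, |j| ≤ m → (T.cod n ⟨x, hx⟩ j = y j ↔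
            ∀ t : ℤ, 0 ≤ t → t < p n → x (j * p n + t) = (f m).1 (j * p n + t)) := by
          intro j hj
          rw [← hf m j hj, cod_eq_iff]
        constructor
        · intro h i hi0 hi1
          have e : i / (p n : ℤ) * p n + i % p n = i := Int.ediv_mul_add_emod i (p n)
          have hj : |i / (p n : ℤ)| ≤ m := by
            rw [abs_le]
            constructor
            · rw [Int.le_ediv_iff_mul_le hp]; linarith
            · have := (Int.ediv_lt_iff_lt_mul hp).2 hi1
              omega
          have := (e1 _ hj).1 (h hx _ hj) (i % p n) (Int.emod_nonneg _ hp.ne')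
            (Int.emod_lt_of_pos _ hp)
          rwa [e] at this
        · intro h hx' j hj
          rw [e1 j hj]
          intro t ht0 ht1
          rw [abs_le] at hj
          apply h
          · have : -(m : ℤ) * p n ≤ j * p n := mul_le_mul_of_nonneg_right hj.1 hp.le
            omega
          · have : j * (p n : ℤ) ≤ m * p n := mul_le_mul_of_nonneg_right hj.2 hp.le
            linarith
      apply IsCompact.nonempty_iInter_of_sequence_nonempty_isCompact_isClosed
      · intro m x hx
        exact ⟨hx.1, fun hx' j hj => hx.2 hx' j (hj.trans (by push_cast; omega))⟩
      · intro m
        exact ⟨(f m).1, (f m).2, fun _ j hj => hf m j hj⟩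
      · rw [key]
        exact (T.closed n).inter_right (win_eq _ _ _).isClosed
      · intro m
        rw [key]
        exact ((T.closed n).inter_right (win_eq _ _ _).isClosed).isClosed
    obtain ⟨x, hx⟩ := hne
    rw [mem_iInter] at hx
    refine ⟨⟨x, (hx 0).1⟩, funext fun j => (hx j.natAbs).2 _ j (by simp)⟩
  · rintro ⟨x, rfl⟩ i m
    have hxX : x.1 ∈ X := (T.phase n).sub x.2
    have hp := T.posz n
    have hO : Win (E ∩ {z | ∀ t : ℤ, 0 ≤ t → t < m * p n → z t = (T.sh n x i).1 t}) :=
      hE.inter (win_eq _ _ _)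
    have hmem : (T.sh n x i).1 ∈ X ∩ E := hGE ▸ (T.sh n x i).2
    obtain ⟨R, hR⟩ := T.good.synd hmem.1 hO.isOpen ⟨hmem.2, fun _ _ _ => rfl⟩
    set k := R + m * p n + 1 with hk
    obtain ⟨z, hz⟩ := (T.phase (n + k)).nonempty T.good.ne
    refine ⟨k, by omega, lam G p (n + k) ⟨z, hz⟩, ?_⟩
    rw [aux_lam]
    obtain ⟨j, hj0, hj1, hj2, hj3⟩ := hR z ((T.phase _).sub hz)
    have hzG : z ∈ G n := T.sub_add n k hz
    obtain ⟨q, rfl⟩ := (T.phase n).dvd T.good.inv hzG (j := j)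
      (by rw [hGE]; exact ⟨T.good.inv _ ((T.phase _).sub hz) _, hj2⟩)
    have hq0 : 0 ≤ q := by nlinarith
    have heq : factorAt (T.cod n x) i m = factorAt (T.cod n (T.down n k ⟨z, hz⟩)) q m := by
      rw [factorAt_ext]
      intro t ht0 ht1
      rw [cod_eq_iff]
      intro s hs0 hs1
      have hb : t * (p n : ℤ) + s < m * p n := by
        have : (t + 1) * (p n : ℤ) ≤ m * p n := mul_le_mul_of_nonneg_right (by omega) hp.le
        nlinarith
      have := hj3 (t * p n + s) (by positivity) hb
      simp only [sh, down, shiftBy] at this ⊢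
      rw [show (i + t) * (p n : ℤ) + s = t * p n + s + i * p n by ring, ← this]
      congr 1; ring
    rw [heq]
    apply factorAt_infix _ hq0
    obtain ⟨M, hM⟩ := T.dvd_add n k
    have hle := T.le_p n k
    rw [hM, Nat.mul_div_cancel_left _ (T.pos n)]
    have h1 : ((R + m * p n + 1 : ℕ) : ℤ) ≤ (p n : ℤ) * M := by
      have : k ≤ p n * M := hM ▸ hle
      exact_mod_cast this
    push_cast at h1
    by_contra hcon
    push Not at hcon
    have : (M : ℤ) * p n ≤ (q + m) * p n := mul_le_mul_of_nonneg_right hcon.le hp.le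
    nlinarith

lemma quot_pos (T : Tower X G p) (n : ℕ) : 0 < p (n + 1) / p n :=
  Nat.div_pos (Nat.le_of_dvd (T.pos _) (T.dvd n)) (T.pos n)

lemma proper_sig (T : Tower X G p) : ProperSeq T.sig := by
  intro n
  obtain ⟨z, hz⟩ := (T.phase (n + 1)).nonempty T.good.ne
  have hp := T.posz n
  have hq := T.quot_pos n
  set q := p (n + 1) / p n with hqd
  have hpq : (p (n + 1) : ℤ) = q * p n := by
    rw [hqd]; exact_mod_cast (Nat.div_mul_cancel (T.dvd n)).symm
  refine ⟨T.cod n (T.down n 1 ⟨z, hz⟩) 0, T.cod n (T.down n 1 ⟨z, hz⟩) ((q : ℤ) - 1), ?_⟩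
  intro a
  obtain ⟨x, rfl⟩ := lam_surj (n + 1) a
  rw [sig_lam, ← hqd]
  obtain ⟨r, hr⟩ : ∃ r, q = r + 1 := ⟨q - 1, by omega⟩
  constructor
  · rw [hr, factorAt_eq, List.range_succ_eq_map]
    simp only [List.map_cons, List.head?_cons, Option.some.injEq]
    rw [cod_eq_iff]
    intro t ht0 ht1
    have := T.proper n x.1 x.2 z hz t (by omega) ht1
    simpa [down] using this
  · rw [hr, factorAt_append]
    have : factorAt (T.cod n (T.down n 1 x)) (0 + (r : ℤ)) 1 = [T.cod n (T.down n 1 x) r] := by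
      simp [factorAt_eq]
    rw [this, List.getLast?_append]
    simp only [List.getLast?_singleton, Option.some_or, Option.some.injEq]
    rw [cod_eq_iff]
    intro t ht0 ht1
    have := T.proper n _ ((T.phase (n + 1)).step T.good.inv x.2) _
      ((T.phase (n + 1)).step T.good.inv hz) (t - p n) (by omega) (by omega)
    simp only [shiftBy, down] at this ⊢
    rw [hpq, hr] at this
    push_cast at this ⊢
    convert this using 2 <;> ring

lemma prim_sig (T : Tower X G p) : PrimitiveSeq T.sig := by
  intro n
  refine ⟨1, one_pos, fun a b => ?_⟩
  obtain ⟨x, rfl⟩ := lam_surj (n + 1) a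
  obtain ⟨y, rfl⟩ := lam_surj n b
  have h := T.aux_lam n 1 x
  rw [h]
  obtain ⟨i, hi0, hi1, hi2⟩ := T.prim n x.1 x.2 y.1 y.2
  have hp := T.posz n
  have e : lam G p n y = T.cod n (T.down n 1 x) i := by
    unfold cod
    rw [lam_eq_iff]
    intro t h0 h1
    rw [← hi2 t h0 h1]
    simp [sh, down, shiftBy, add_comm]
  rw [e]
  apply mem_factorAt _ hi0
  obtain ⟨m, hm⟩ := T.dvd n
  rw [hm, Nat.mul_div_cancel_left _ (T.pos n)]
  rw [hm] at hi1
  push_cast at hi1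
  by_contra hcon
  push Not at hcon
  nlinarith

lemma centered (T : Tower X G p) (n : ℕ) (z : ℤ → TB G p n) (x : ↥(G (n + 1))) (k : ℕ)
    (h : IsConcat (T.sig n) (T.cod (n + 1) x) (fun m => z (m - k))) :
    ∀ i : ℤ, z (i - k) = T.cod n (T.down n 1 x) i := by
  obtain ⟨c, hc0, hc1, hc2⟩ := h
  have hq := T.quot_pos n
  set q := p (n + 1) / p n with hqd
  have hqz : (0 : ℤ) < q := by exact_mod_cast hq
  have hpq : (p (n + 1) : ℤ) = q * p n := by
    rw [hqd]; exact_mod_cast (Nat.div_mul_cancel (T.dvd n)).symm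
  have hsig : ∀ j : ℤ, T.sig n (T.cod (n + 1) x j) = factorAt (T.cod n (T.down n 1 x)) (j * q) q := by
    intro j
    unfold cod
    rw [sig_lam, ← hqd, factorAt_ext]
    intro t _ _
    change T.cod _ _ _ = T.cod _ _ _
    rw [cod_eq_iff]
    intro s _ _
    simp only [down, sh, shiftBy]
    rw [hpq]; ring_nf
  have hlen : ∀ j : ℤ, (T.sig n (T.cod (n + 1) x j)).length = q := by
    intro j; rw [hsig, factorAt_length]
  have hc : ∀ j : ℤ, c j = j * q := by
    intro j
    induction j using Int.induction_on with
    | zero => simp [hc0]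
    | succ i ih => rw [hc1, ih, hlen]; ring
    | pred i ih =>
      have := hc1 (-i - 1)
      rw [hlen, sub_add_cancel, ih] at this
      linarith
  intro i
  have e : i / (q : ℤ) * q + i % q = i := Int.ediv_mul_add_emod i q
  have m0 := Int.emod_nonneg i hqz.ne'
  have m1 := Int.emod_lt_of_pos i hqz
  obtain ⟨r, hr⟩ := Int.eq_ofNat_of_zero_le m0
  have hrq : r < q := by rw [hr] at m1; exact_mod_cast m1
  have h2 := hc2 (i / q) ⟨r, by rw [hlen]; exact hrq⟩
  simp only [hc, List.get_eq_getElem] at h2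
  rw [hr] at e
  rw [e] at h2
  rw [h2]
  have h3 : ∀ (l : List (TB G p n)) (hl : r < l.length),
      l = factorAt (T.cod n (T.down n 1 x)) (i / q * q) q →
      l[r] = T.cod n (T.down n 1 x) i := by
    intro l hl hle
    subst hle
    simp only [factorAt_eq, List.getElem_map, List.getElem_range]
    rw [e]
  exact h3 _ _ (hsig _)

lemma recog_sig (T : Tower X G p) : RecognizableSeq T.sig := by
  intro n z y y' k k' h h'
  obtain ⟨hy, hk, hc⟩ := h
  obtain ⟨hy', hk', hc'⟩ := h'
  rw [xlevel] at hy hy'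
  obtain ⟨x, rfl⟩ := hy
  obtain ⟨x', rfl⟩ := hy'
  have hl : ∀ w, (T.sig n w).length = p (n + 1) / p n := fun w => factorAt_length _ _ _
  rw [hl] at hk hk'
  have h1 := T.centered n z x k hc
  have h2 := T.centered n z x' k' hc'
  have hp := T.posz n
  have h3 : T.sh n (T.down n 1 x) k = T.sh n (T.down n 1 x') k' := by
    apply T.cod_inj
    funext i
    rw [cod_sh, cod_sh, ← h1, ← h2]
    congr 1; ring
  have h4 : shiftBy ((k : ℤ) * p n) x.1 = shiftBy ((k' : ℤ) * p n) x'.1 := congrArg Subtype.val h3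
  set w := shiftBy (-(p (n + 1) : ℤ)) (shiftBy ((k : ℤ) * p n) x.1) with hw
  have hwX : w ∈ X := T.good.inv _ (T.good.inv _ ((T.phase _).sub x.2) _) _
  have hb : ∀ l : ℕ, l < p (n + 1) / p n → (l : ℤ) * p n < p (n + 1) := by
    intro l hlt
    have := T.block_le n 1 (i := l) (t := 0) (by exact_mod_cast hlt) hp
    simpa using this
  have key : ((k : ℤ) * p n) = ((k' : ℤ) * p n) := by
    have hX := (T.phase (n + 1)).sub x.2
    have b1 := hb k hk
    have b2 := hb k' hk'
    have e : x'.1 = shiftBy (-((k' : ℤ) * p n)) (shiftBy ((k : ℤ) * p n) x.1) := by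
      rw [h4, shiftBy_shiftBy]; simp [shiftBy_zero]
    have hd := (T.phase (n + 1)).dvd T.good.inv x.2 (j := -((k' : ℤ) * p n) + k * p n)
      (by rw [← shiftBy_shiftBy, ← e]; exact x'.2)
    have c1 : 0 ≤ (k : ℤ) * p n := by positivity
    have c2 : 0 ≤ (k' : ℤ) * p n := by positivity
    have := Int.eq_zero_of_abs_lt_dvd hd (by rw [abs_lt]; constructor <;> linarith)
    linarith
  have hkk : k = k' := by
    have := mul_right_cancel₀ hp.ne' key
    exact_mod_cast this
  refine ⟨?_, hkk⟩
  have : x = x' := by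
    apply Subtype.ext
    have e := congrArg (shiftBy (-((k : ℤ) * p n))) h4
    rw [← key, shiftBy_shiftBy, shiftBy_shiftBy] at e
    simpa [shiftBy_zero] using e
  rw [this]

lemma card_le (T : Tower X G p) (n : ℕ) (i : Fintype (TB G p (n + 1))) :
    @Fintype.card (TB G p (n + 1)) i ≤ 2 := by
  obtain ⟨u, v, huv⟩ := T.two n
  classical
  let s : Finset (List ℤ) := {factorAt u 0 (p (n + 1)), factorAt v 0 (p (n + 1))}
  have hs : s.card ≤ 2 := Finset.card_le_two
  refine le_trans ?_ hs
  rw [← Fintype.card_coe s]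
  refine Fintype.card_le_of_injective (fun w : TB G p (n + 1) => (⟨w.1, ?_⟩ : s)) ?_
  · obtain ⟨w, x, hx, rfl⟩ := w
    simp only [s, Finset.mem_insert, Finset.mem_singleton, factorAt_ext, zero_add]
    exact huv x hx
  · intro a b hab
    exact Subtype.ext (congrArg (fun z : s => z.1) hab)

lemma finite_alph (T : Tower X G p) (n : ℕ) : Finite (TB G p n) := by
  cases n with
  | zero =>
    have h1 : ((fun x : ℤ → ℤ => x 0) '' X).Finite :=
      (T.good.cpt.image (continuous_apply 0)).finite_of_discrete
    have := h1.to_subtype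
    refine Finite.of_injective (β := ↥((fun x : ℤ → ℤ => x 0) '' X))
      (fun w => ⟨(T.rep 0 w).1 0, (T.rep 0 w).1, (T.phase 0).sub (T.rep 0 w).2, rfl⟩) ?_
    intro a b hab
    rw [← T.lam_rep 0 a, ← T.lam_rep 0 b, lam_eq_iff]
    intro t h0 h1
    rw [T.pzero] at h1
    have : t = 0 := by push_cast at h1; omega
    subst this
    exact congrArg Subtype.val hab
  | succ n =>
    obtain ⟨u, v, huv⟩ := T.two n
    have : ({factorAt u 0 (p (n + 1)), factorAt v 0 (p (n + 1))} : Set (List ℤ)).Finite := by simp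
    have := this.to_subtype
    refine Finite.of_injective (β := ↥({factorAt u 0 (p (n + 1)), factorAt v 0 (p (n + 1))} : Set (List ℤ)))
      (fun w => ⟨w.1, ?_⟩) ?_
    · obtain ⟨w, x, hx, rfl⟩ := w
      simp only [mem_insert_iff, mem_singleton_iff, factorAt_ext, zero_add]
      exact huv x hx
    · intro a b hab
      have := congrArg Subtype.val hab
      exact Subtype.ext this

lemma conj (T : Tower X G p) : @Conjugate ℤ (TB G p 0) _ ⊥ X (XLevel T.sig 0) := by
  let _ : TopologicalSpace (TB G p 0) := ⊥
  have _ : DiscreteTopology (TB G p 0) := ⟨rfl⟩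
  have hmem : ∀ x : ↥X, x.1 ∈ G 0 := fun x => by rw [T.zero]; exact x.2
  let f : ↥X → ↥(XLevel T.sig 0) := fun x => ⟨T.cod 0 ⟨x.1, hmem x⟩, by
    rw [xlevel]; exact ⟨_, rfl⟩⟩
  have hcoord : ∀ (x y : ↥X) (i : ℤ), x.1 i = y.1 i →
      T.cod 0 ⟨x.1, hmem x⟩ i = T.cod 0 ⟨y.1, hmem y⟩ i := by
    intro x y i h
    rw [cod_eq_iff]
    intro t h0 h1
    rw [T.pzero] at h1 ⊢
    have : t = 0 := by push_cast at h1; omega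
    subst this
    simpa using h
  have hf : Continuous f := by
    refine Continuous.subtype_mk ?_ _
    refine continuous_pi fun i => ?_
    rw [continuous_discrete_rng]
    intro b
    rw [isOpen_iff_mem_nhds]
    intro x hx
    have ho : IsOpen {y : ↥X | y.1 i = x.1 i} :=
      (isOpen_discrete ({x.1 i} : Set ℤ)).preimage
        ((continuous_apply (A := fun _ : ℤ => ℤ) i).comp continuous_subtype_val)
    refine Filter.mem_of_superset (ho.mem_nhds rfl) ?_
    intro y hy
    have := hcoord y x i hy
    show T.cod 0 ⟨y.1, hmem y⟩ i = b
    rw [this]; exact hx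
  have hbij : Function.Bijective f := by
    constructor
    · intro x y hxy
      have := T.cod_inj 0 (congrArg Subtype.val hxy)
      have h2 := congrArg Subtype.val this
      exact Subtype.ext h2
    · rintro ⟨y, hy⟩
      have hy' := hy
      rw [xlevel] at hy'
      obtain ⟨x, rfl⟩ := hy'
      exact ⟨⟨x.1, (T.phase 0).sub x.2⟩, rfl⟩
  have : CompactSpace ↥X := isCompact_iff_compactSpace.1 T.good.cpt
  let φ : ↥X ≃ₜ ↥(XLevel T.sig 0) :=
    Continuous.homeoOfEquivCompactToT2 (f := Equiv.ofBijective f hbij) hf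
  refine ⟨φ, fun x hx hx' => ?_⟩
  funext i
  show T.cod 0 ⟨shift x, _⟩ i = T.cod 0 ⟨x, _⟩ (i + 1)
  rw [cod_eq_iff]
  intro t _ _
  rw [T.pzero]
  simp only [shift]
  push_cast
  ring_nf

theorem strong (T : Tower X G p) : IsStrongToeplitzOfRank X 2 := by
  have hfin := T.finite_alph
  refine ⟨TB G p, fun n => Fintype.ofFinite _, T.sig, ?_, ?_, T.prim_sig, T.proper_sig,
    T.recog_sig, ?_, T.conj⟩
  · intro n a h
    have := congrArg List.length h
    unfold sig at this
    rw [factorAt_length] at this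
    have h2 := T.quot_pos n
    simp only [List.length_nil] at this
    omega
  · intro n a b
    unfold sig
    rw [factorAt_length, factorAt_length]
  · intro N
    exact ⟨N + 1, by omega, T.card_le N _⟩

end Tower


end Part4

section Part5

/-! ### Part 5: density -/

open Classical in
/-- Substitution of the blocks `a` and `b` of length `m`. -/
noncomputable def th (m : ℤ) (a b : ℤ → ℤ) (z : ℤ → Prop) : ℤ → ℤ :=
  fun i => if z (i / m) then b (i % m) else a (i % m)

lemma th_pos {m : ℤ} {a b : ℤ → ℤ} {z : ℤ → Prop} {q e : ℤ} (h0 : 0 ≤ e) (h1 : e < m)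
    (hz : z q) : th m a b z (q * m + e) = b e := by
  have hm : 0 < m := by omega
  have e1 : (q * m + e) / m = q := by
    rw [add_comm, Int.add_mul_ediv_right _ _ hm.ne', Int.ediv_eq_zero_of_lt h0 h1, zero_add]
  have e2 : (q * m + e) % m = e := by
    rw [add_comm, Int.add_mul_emod_self_right, Int.emod_eq_of_lt h0 h1]
  unfold th
  rw [e1, e2, if_pos hz]

lemma th_neg {m : ℤ} {a b : ℤ → ℤ} {z : ℤ → Prop} {q e : ℤ} (h0 : 0 ≤ e) (h1 : e < m)
    (hz : ¬ z q) : th m a b z (q * m + e) = a e := by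
  have hm : 0 < m := by omega
  have e1 : (q * m + e) / m = q := by
    rw [add_comm, Int.add_mul_ediv_right _ _ hm.ne', Int.ediv_eq_zero_of_lt h0 h1, zero_add]
  have e2 : (q * m + e) % m = e := by
    rw [add_comm, Int.add_mul_emod_self_right, Int.emod_eq_of_lt h0 h1]
  unfold th
  rw [e1, e2, if_neg hz]

lemma th_congr {m : ℤ} {a b : ℤ → ℤ} {z z' : ℤ → Prop} {q q' e : ℤ} (h0 : 0 ≤ e) (h1 : e < m)
    (hz : z q ↔ z' q') : th m a b z (q * m + e) = th m a b z' (q' * m + e) := by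
  by_cases h : z q
  · rw [th_pos h0 h1 h, th_pos h0 h1 (hz.1 h)]
  · rw [th_neg h0 h1 h, th_neg h0 h1 (fun h' => h (hz.2 h'))]

lemma th_ne_iff {m : ℤ} {a b : ℤ → ℤ} {z z' : ℤ → Prop} {q q' e : ℤ} (h0 : 0 ≤ e) (h1 : e < m) :
    th m a b z (q * m + e) ≠ th m a b z' (q' * m + e) ↔ ¬ (z q ↔ z' q') ∧ a e ≠ b e := by
  by_cases h : z q <;> by_cases h' : z' q'
  · simp [th_pos h0 h1 h, th_pos h0 h1 h', h, h']
  · simp [th_pos h0 h1 h, th_neg h0 h1 h', h, h', eq_comm]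
  · simp [th_neg h0 h1 h, th_pos h0 h1 h', h, h']
  · simp [th_neg h0 h1 h, th_neg h0 h1 h', h, h']

lemma decomp {m : ℤ} (hm : 0 < m) (i : ℤ) : ∃ q e, i = q * m + e ∧ 0 ≤ e ∧ e < m :=
  ⟨i / m, i % m, by rw [mul_comm]; exact (Int.mul_ediv_add_emod i m).symm,
    Int.emod_nonneg _ hm.ne', Int.emod_lt_of_pos _ hm⟩

/-- Uniform recurrence of all words of length `n`. -/
lemma GoodS.words {X : Set (ℤ → ℤ)} (h : GoodS X) (n : ℕ) :
    ∃ R : ℕ, ∀ x ∈ X, ∀ y ∈ X, ∃ i : ℤ, 0 ≤ i ∧ i < R ∧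
      ∀ t : ℤ, 0 ≤ t → t < n → x (i + t) = y t := by
  have ho : ∀ y : ℤ → ℤ, IsOpen {x : ℤ → ℤ | ∀ i : ℤ, 0 ≤ i → i < n → x i = y i} :=
    fun y => (win_eq 0 n y).isOpen
  have hs := fun y : ↥X => h.synd y.2 (ho y.1) (fun i _ _ => rfl)
  choose R hR using hs
  obtain ⟨s, hs⟩ := h.cpt.elim_nhds_subcover'
    (fun y _ => {x : ℤ → ℤ | ∀ i : ℤ, 0 ≤ i → i < n → x i = y i})
    (fun y _ => (ho y).mem_nhds (fun i _ _ => rfl))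
  refine ⟨s.sup R, fun x hx y hy => ?_⟩
  have hy' := hs hy
  simp only [mem_iUnion, exists_prop] at hy'
  obtain ⟨c, hc, hyc⟩ := hy'
  obtain ⟨i, h0, h1, h2⟩ := hR c x hx
  have hle : R c ≤ s.sup R := Finset.le_sup hc
  refine ⟨i, h0, by omega, fun t ht0 ht1 => ?_⟩
  have e1 := h2 t ht0 ht1
  have e2 := hyc t ht0 ht1
  simp only [shiftBy] at e1
  rw [e2, ← e1, add_comm]

lemma GoodS.not_per {X : Set (ℤ → ℤ)} (h : GoodS X) {x : ℤ → ℤ} (hx : x ∈ X) {j : ℕ} (hj : 0 < j) :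
    ∃ t : ℤ, 0 ≤ t ∧ x t ≠ x (t + j) := by
  by_contra hcon
  push Not at hcon
  have hper : ∀ y ∈ X, ∀ i : ℤ, y (i + j) = y i := by
    intro y hy i
    by_contra hne
    have hw : Win {z : ℤ → ℤ | z (i + j) ≠ z i} := by
      refine ⟨i.natAbs + j, fun x y hxy hx => ?_⟩
      simp only [mem_ofPred_eq] at hx ⊢
      rw [← hxy, ← hxy]
      · exact hx
      · rw [abs_le]; constructor <;> omega
      · rw [abs_le]; constructor <;> omega
    obtain ⟨R, hR⟩ := h.synd hy hw.isOpen hne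
    obtain ⟨s, h0, h1, h2⟩ := hR _ (h.inv x hx i.natAbs)
    apply h2
    simp only [shiftBy]
    have := hcon (i + s + i.natAbs) (by omega)
    rw [this]
    congr 1; omega
  apply h.inf
  have hfin : ((fun y : ℤ → ℤ => fun i : Fin j => y (i : ℕ)) '' X).Finite :=
    (h.cpt.image (by fun_prop)).finite_of_discrete
  refine hfin.of_finite_image ?_
  intro y hy z hz hyz
  have hmul : ∀ y ∈ X, ∀ q e : ℤ, y (q * j + e) = y e := by
    intro y hy q e
    induction q using Int.induction_on with
    | zero => simp
    | succ i ih => rw [← ih, ← hper y hy ((i : ℤ) * j + e)]; congr 1; ring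
    | pred i ih => rw [← ih, ← hper y hy (_ + e)]; congr 1; ring
  funext i
  obtain ⟨q, e, rfl, he0, he1⟩ := decomp (m := j) (by exact_mod_cast hj) i
  rw [hmul y hy, hmul z hz]
  have := congrFun hyz ⟨e.toNat, by omega⟩
  simpa [Int.toNat_of_nonneg he0] using this

/-- Two blocks whose free concatenations have the same `n`-words as `X`. -/
lemma GoodS.blocks {X : Set (ℤ → ℤ)} (h : GoodS X) (n : ℕ) :
    ∃ (m : ℕ) (a b : ℤ → ℤ), (∃ d : ℤ, 0 ≤ d ∧ d < m ∧ a d ≠ b d) ∧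
      ∀ z : ℤ → Prop,
        (∀ i : ℤ, ∃ x ∈ X, ∃ P : ℤ, ∀ t : ℤ, 0 ≤ t → t < n → th m a b z (i + t) = x (P + t)) ∧
        (∀ x ∈ X, ∀ P : ℤ, ∃ i : ℤ, ∀ t : ℤ, 0 ≤ t → t < n → th m a b z (i + t) = x (P + t)) := by
  obtain ⟨x, hx⟩ := h.ne
  obtain ⟨R, hR⟩ := h.words n
  have hret : ∀ J : ℕ, ∃ j : ℕ, J ≤ j ∧ ∀ t : ℤ, 0 ≤ t → t < n → x (j + t) = x t := by
    intro J
    obtain ⟨i, h0, h1, h2⟩ := hR _ (h.inv x hx J) x hx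
    refine ⟨i.toNat + J, by omega, fun t a b => ?_⟩
    rw [← h2 t a b]
    simp only [shiftBy]
    congr 1
    push_cast
    omega
  obtain ⟨j, hj, hjx⟩ := hret (R + n + 1)
  obtain ⟨t, ht0, ht⟩ := h.not_per hx (j := j) (by omega)
  obtain ⟨m, hm, hmx⟩ := hret (j + n + t.toNat + 1)
  have hm1 : (j : ℤ) + n + t + 1 ≤ m := by omega
  have hj1 : (R : ℤ) + n + 1 ≤ j := by omega
  clear hm hj
  set b : ℤ → ℤ := fun s => if s < (m : ℤ) - j then x (s + j) else x (s - m + j) with hb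
  have hb1 : ∀ s : ℤ, s < (m : ℤ) - j → b s = x (s + j) := fun s hs => by simp [hb, hs]
  have hb2 : ∀ s : ℤ, (m : ℤ) - j ≤ s → b s = x (s - m + j) := fun s hs => by
    simp [hb, not_lt.2 hs]
  refine ⟨m, x, b, ⟨t, ht0, by omega, ?_⟩, fun z => ?_⟩
  · rw [hb1 t (by omega)]; exact ht
  have hstart : ∀ q e : ℤ, 0 ≤ e → e < n → th m x b z (q * m + e) = x e := by
    intro q e h0 h1
    by_cases hz : z q
    · rw [th_pos h0 (by omega) hz, hb1 e (by omega), ← hjx e h0 h1, add_comm]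
    · rw [th_neg h0 (by omega) hz]
  have hA : ∀ q s : ℤ, 0 ≤ s → s < m → ¬ z q → ∀ t : ℤ, 0 ≤ t → t < n →
      th m x b z (q * m + s + t) = x (s + t) := by
    intro q s h0 h1 hz t h2 h3
    by_cases h4 : s + t < m
    · rw [add_assoc, th_neg (by omega) h4 hz]
    · have := hstart (q + 1) (s + t - m) (by omega) (by omega)
      rw [← hmx _ (by omega) (by omega)] at this
      convert this using 2 <;> ring
  have hB : ∀ q s : ℤ, 0 ≤ s → s < m - j → z q → ∀ t : ℤ, 0 ≤ t → t < n →
      th m x b z (q * m + s + t) = x (s + j + t) := by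
    intro q s h0 h1 hz t h2 h3
    rw [add_assoc, th_pos (by omega) (by omega) hz]
    by_cases h4 : s + t < m - j
    · rw [hb1 _ h4]; congr 1; ring
    · rw [hb2 _ (by omega), ← hmx _ (by omega) (by omega)]; congr 1; ring
  have hB' : ∀ q s : ℤ, m - j ≤ s → s < m → z q → ∀ t : ℤ, 0 ≤ t → t < n →
      th m x b z (q * m + s + t) = x (s - m + j + t) := by
    intro q s h0 h1 hz t h2 h3
    by_cases h4 : s + t < m
    · rw [add_assoc, th_pos (by omega) h4 hz, hb2 _ (by omega)]; congr 1; ring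
    · have := hstart (q + 1) (s + t - m) (by omega) (by omega)
      rw [← hjx _ (by omega) (by omega)] at this
      convert this using 2 <;> ring
  constructor
  · intro i
    obtain ⟨q, s, rfl, h0, h1⟩ := decomp (m := m) (by omega) i
    refine ⟨x, hx, ?_⟩
    by_cases hz : z q
    · by_cases hs : s < m - j
      · exact ⟨_, hB q s h0 hs hz⟩
      · exact ⟨_, hB' q s (by omega) h1 hz⟩
    · exact ⟨_, hA q s h0 h1 hz⟩
  · intro y hy P
    obtain ⟨i, h0, h1, h2⟩ := hR x hx _ (h.inv y hy P)
    have h3 : ∀ t : ℤ, 0 ≤ t → t < n → x (i + t) = y (P + t) := fun t a b => by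
      rw [h2 t a b, shiftBy, add_comm]
    by_cases hz : z 0
    · refine ⟨0 * m + (i + m - j), fun t a b => ?_⟩
      rw [hB' 0 _ (by omega) (by omega) hz t a b, ← h3 t a b]
      congr 1; ring
    · refine ⟨0 * m + i, fun t a b => ?_⟩
      rw [hA 0 i h0 (by omega) hz t a b, h3 t a b]

/-- The coding words. -/
def CW (s : ℤ) (β : Prop) (r : ℤ) : Prop :=
  (7 ≤ r ∧ r % 2 = 1) ↔ ¬ (β ∧ (r = s ∨ r = 2 * s ∨ r = 4 * s))

def Zs (s : ℤ) (w : ℤ → Prop) (i : ℤ) : Prop := CW s (w (i / (8 * s))) (i % (8 * s))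

lemma Zs_eval {s : ℤ} {w : ℤ → Prop} {Q r : ℤ} (h0 : 0 ≤ r) (h1 : r < 8 * s) :
    Zs s w (Q * (8 * s) + r) ↔ CW s (w Q) r := by
  have hm : 0 < 8 * s := by omega
  have e1 : (Q * (8 * s) + r) / (8 * s) = Q := by
    rw [add_comm, Int.add_mul_ediv_right _ _ hm.ne', Int.ediv_eq_zero_of_lt h0 h1, zero_add]
  have e2 : (Q * (8 * s) + r) % (8 * s) = r := by
    rw [add_comm, Int.add_mul_emod_self_right, Int.emod_eq_of_lt h0 h1]
  unfold Zs
  rw [e1, e2]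

lemma CW_noflip {s : ℤ} {β : Prop} {r : ℤ} (h1 : r ≠ s) (h2 : r ≠ 2 * s) (h4 : r ≠ 4 * s) :
    CW s β r ↔ (7 ≤ r ∧ r % 2 = 1) := by
  unfold CW
  simp [h1, h2, h4]

lemma CW_flip {s : ℤ} {β β' : Prop} {r : ℤ} (h : ¬ (β ↔ β')) :
    ¬ (CW s β r ↔ CW s β' r) ↔ (r = s ∨ r = 2 * s ∨ r = 4 * s) := by
  unfold CW
  generalize (r = s ∨ r = 2 * s ∨ r = 4 * s) = F
  generalize (7 ≤ r ∧ r % 2 = 1) = G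
  by_cases hF : F <;> by_cases hG : G <;> by_cases hb : β <;> by_cases hb' : β' <;>
    simp_all

lemma run_lemma {s : ℤ} (hs : 10 ≤ s) {w : ℤ → Prop} {q : ℤ}
    (hc : ∀ i : ℤ, 1 ≤ i → i ≤ 5 → (Zs s w (q + i) ↔ Zs s w (q + i + 1))) :
    ∃ Q : ℤ, q = Q * (8 * s) ∨ q = Q * (8 * s) - 1 := by
  obtain ⟨Q, r, rfl, h0, h1⟩ := decomp (m := 8 * s) (by omega) q
  have key : ∀ i : ℤ, 1 ≤ i → i ≤ 5 → r + i + 1 < 8 * s →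
      (CW s (w Q) (r + i) ↔ CW s (w Q) (r + i + 1)) := by
    intro i hi0 hi1 hi2
    have := hc i hi0 hi1
    rw [add_assoc, Zs_eval (by omega) (by omega), add_assoc, add_assoc,
      Zs_eval (by omega) (by omega)] at this
    simpa [add_assoc] using this
  by_cases hr0 : r = 0
  · exact ⟨Q, Or.inl (by omega)⟩
  by_cases hr1 : r = 8 * s - 1
  · exact ⟨Q + 1, Or.inr (by rw [add_mul]; omega)⟩
  exfalso
  by_cases hr2 : r = 8 * s - 2
  · have := hc 1 le_rfl (by norm_num)
    have e : Q * (8 * s) + r + 1 + 1 = (Q + 1) * (8 * s) + 0 := by rw [add_mul]; omega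
    rw [e, add_assoc, Zs_eval (by omega) (by omega), Zs_eval (by omega) (by omega)] at this
    rw [CW_noflip (by omega) (by omega) (by omega), CW_noflip (by omega) (by omega) (by omega)]
      at this
    omega
  by_cases hr3 : r ≤ 5
  · have := key (6 - r) (by omega) (by omega) (by omega)
    rw [CW_noflip (by omega) (by omega) (by omega), CW_noflip (by omega) (by omega) (by omega)]
      at this
    omega
  by_cases hr4 : r + 6 < 8 * s
  · by_cases c1 : r + 1 ≠ s ∧ r + 1 + 1 ≠ s ∧ r + 1 ≠ 2 * s ∧ r + 1 + 1 ≠ 2 * s ∧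
          r + 1 ≠ 4 * s ∧ r + 1 + 1 ≠ 4 * s
    · have k1 := key 1 (by omega) (by omega) (by omega)
      rw [CW_noflip (by omega) (by omega) (by omega), CW_noflip (by omega) (by omega) (by omega)]
        at k1
      omega
    · have k3 := key 3 (by omega) (by omega) (by omega)
      rw [CW_noflip (by omega) (by omega) (by omega), CW_noflip (by omega) (by omega) (by omega)]
        at k3
      omega
  · have := key (8 * s - 2 - r) (by omega) (by omega) (by omega)
    rw [CW_noflip (by omega) (by omega) (by omega), CW_noflip (by omega) (by omega) (by omega)]
      at this
    omega

/-- The test set. -/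
def TE (m d : ℤ) : Set (ℤ → ℤ) :=
  {y | (∀ i : ℤ, 0 ≤ i → i < 6 * m + d → y i = y (i + m)) ∧ y (6 * m + d) ≠ y (6 * m + d + m)}

/-- Parameters of the construction. -/
structure Par (m s d : ℤ) (a b : ℤ → ℤ) : Prop where
  hs : 10 ≤ s
  d0 : 0 ≤ d
  dm : d < m
  hd : a d ≠ b d
  mind : ∀ e : ℤ, 0 ≤ e → e < d → a e = b e

lemma Par.test {m s d : ℤ} {a b : ℤ → ℤ} (P : Par m s d a b) (w : ℤ → Prop) (i : ℤ) :
    shiftBy i (th m a b (Zs s w)) ∈ TE m d ↔ ∃ Q : ℤ, i = Q * (8 * s * m) := by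
  obtain ⟨hs, d0, dm, hd, mind⟩ := P
  have low : ∀ Q r : ℤ, 0 ≤ r → r < 6 →
      (Zs s w (Q * (8 * s) + r) ↔ Zs s w (Q * (8 * s) + r + 1)) := by
    intro Q r h0 h1
    rw [Zs_eval (by omega) (by omega), add_assoc, Zs_eval (by omega) (by omega)]
    rw [CW_noflip (by omega) (by omega) (by omega), CW_noflip (by omega) (by omega) (by omega)]
    omega
  have six : ∀ Q : ℤ, ¬ (Zs s w (Q * (8 * s) + 6) ↔ Zs s w (Q * (8 * s) + 6 + 1)) := by
    intro Q
    rw [Zs_eval (by omega) (by omega), add_assoc, Zs_eval (by omega) (by omega)]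
    rw [CW_noflip (by omega) (by omega) (by omega), CW_noflip (by omega) (by omega) (by omega)]
    omega
  have brk : ∀ q e : ℤ, 0 ≤ e → e < m →
      (th m a b (Zs s w) (q * m + e) ≠ th m a b (Zs s w) (q * m + e + m) ↔
        ¬ (Zs s w q ↔ Zs s w (q + 1)) ∧ a e ≠ b e) := by
    intro q e h0 h1
    have : q * m + e + m = (q + 1) * m + e := by ring
    rw [this, th_ne_iff h0 h1]
  constructor
  · rintro ⟨h1, h2⟩
    simp only [shiftBy] at h1 h2
    have h1' : ∀ j : ℤ, i ≤ j → j < i + 6 * m + d →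
        th m a b (Zs s w) j = th m a b (Zs s w) (j + m) := by
      intro j hj0 hj1
      have := h1 (j - i) (by omega) (by omega)
      convert this using 2 <;> ring
    have h2' : th m a b (Zs s w) (i + 6 * m + d) ≠ th m a b (Zs s w) (i + 6 * m + d + m) := by
      convert h2 using 2 <;> ring_nf
    clear h1 h2
    obtain ⟨q, e, rfl, e0, e1⟩ := decomp (m := m) (by omega) i
    have hrun : ∃ Q : ℤ, q = Q * (8 * s) ∨ q = Q * (8 * s) - 1 := by
      apply run_lemma hs (w := w)
      intro l hl0 hl1
      by_contra hcon
      have := (brk (q + l) d d0 dm).2 ⟨hcon, hd⟩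
      apply this
      have e3 : m ≤ l * m := by nlinarith
      have e4 : l * m ≤ 5 * m := by nlinarith
      apply h1' <;> rw [add_mul] <;> omega
    obtain ⟨Q, rfl | rfl⟩ := hrun
    · refine ⟨Q, ?_⟩
      have : e = 0 := by
        by_contra hne
        have h3 := (brk (Q * (8 * s) + 6) d d0 dm).2 ⟨six Q, hd⟩
        apply h3
        apply h1' <;> rw [add_mul] <;> omega
      rw [this]; ring
    · exfalso
      by_cases hde : d + e < m
      · have e5 : (Q * (8 * s) - 1) * m + e + 6 * m + d = (Q * (8 * s) + 5) * m + (d + e) := by ring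
        rw [e5] at h2'
        exact ((brk _ _ (by omega) hde).1 h2').1 (low Q 5 (by norm_num) (by norm_num))
      · have e5 : (Q * (8 * s) - 1) * m + e + 6 * m + d = (Q * (8 * s) + 6) * m + (d + e - m) := by
          ring
        rw [e5] at h2'
        exact ((brk _ _ (by omega) (by omega)).1 h2').2 (mind _ (by omega) (by omega))
  · rintro ⟨Q, rfl⟩
    constructor
    · intro i h0 h1
      simp only [shiftBy]
      obtain ⟨r, e, rfl, e0, e1⟩ := decomp (m := m) (by omega) i
      by_contra hne
      have e5 : r * m + e + Q * (8 * s * m) = (Q * (8 * s) + r) * m + e := by ring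
      have e6 : r * m + e + m + Q * (8 * s * m) = (Q * (8 * s) + r) * m + e + m := by ring
      rw [e5, e6] at hne
      obtain ⟨h3, h4⟩ := (brk _ _ e0 e1).1 hne
      have hr0 : 0 ≤ r := by nlinarith
      by_cases hr : r < 6
      · exact h3 (low Q r hr0 hr)
      · have : 6 * m ≤ r * m := by nlinarith
        exact h4 (mind e e0 (by omega))
    · simp only [shiftBy]
      have e5 : 6 * m + d + Q * (8 * s * m) = (Q * (8 * s) + 6) * m + d := by ring
      have e6 : 6 * m + d + m + Q * (8 * s * m) = (Q * (8 * s) + 6) * m + d + m := by ring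
      rw [e5, e6]
      exact (brk _ _ d0 dm).2 ⟨six Q, hd⟩

lemma Par.shift_mul {m s d : ℤ} {a b : ℤ → ℤ} (P : Par m s d a b) (w : ℤ → Prop) (Q : ℤ) :
    shiftBy (Q * (8 * s * m)) (th m a b (Zs s w)) = th m a b (Zs s (shiftBy Q w)) := by
  obtain ⟨hs, d0, dm, hd, mind⟩ := P
  funext i
  obtain ⟨q, e, rfl, e0, e1⟩ := decomp (m := m) (by omega) i
  simp only [shiftBy]
  have : q * m + e + Q * (8 * s * m) = (q + Q * (8 * s)) * m + e := by ring
  rw [this]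
  apply th_congr e0 e1
  unfold Zs
  rw [Int.add_mul_ediv_right _ _ (by omega), Int.add_mul_emod_self_right]
  exact Iff.rfl

lemma Par.first {m s d : ℤ} {a b : ℤ → ℤ} (P : Par m s d a b) {w w' : ℤ → Prop}
    (h : w 0 ↔ w' 0) {i : ℤ} (h0 : 0 ≤ i) (h1 : i < 8 * s * m) :
    th m a b (Zs s w) i = th m a b (Zs s w') i := by
  obtain ⟨hs, d0, dm, hd, mind⟩ := P
  obtain ⟨q, e, rfl, e0, e1⟩ := decomp (m := m) (by omega) i
  apply th_congr e0 e1
  have hq0 : 0 ≤ q := by nlinarith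
  have hq1 : q < 8 * s := by nlinarith
  have e := Zs_eval (w := w) (Q := 0) hq0 hq1
  have e' := Zs_eval (w := w') (Q := 0) hq0 hq1
  rw [zero_mul, zero_add] at e e'
  rw [e, e', h]

lemma Par.diff {m s d : ℤ} {a b : ℤ → ℤ} (P : Par m s d a b) {w w' : ℤ → Prop}
    (h : ¬ (w 0 ↔ w' 0)) {q e : ℤ} (h0 : 0 ≤ q) (h1 : q < 8 * s) (e0 : 0 ≤ e) (e1 : e < m) :
    th m a b (Zs s w) (q * m + e) ≠ th m a b (Zs s w') (q * m + e) ↔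
      (q = s ∨ q = 2 * s ∨ q = 4 * s) ∧ a e ≠ b e := by
  rw [th_ne_iff e0 e1]
  have e := Zs_eval (w := w) (Q := 0) h0 h1
  have e' := Zs_eval (w := w') (Q := 0) h0 h1
  rw [zero_mul, zero_add] at e e'
  rw [e, e', CW_flip h]

lemma Par.inj {m s d : ℤ} {a b : ℤ → ℤ} (P : Par m s d a b) {w w' : ℤ → Prop}
    (h : th m a b (Zs s w) = th m a b (Zs s w')) : w = w' := by
  funext Q
  by_contra hne
  have hne' : ¬ ((shiftBy Q w) 0 ↔ (shiftBy Q w') 0) := by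
    simpa [shiftBy] using hne
  have := (P.diff hne' (q := s) (e := d) (by linarith [P.hs]) (by linarith [P.hs]) P.d0 P.dm).2
    ⟨Or.inl rfl, P.hd⟩
  rw [← P.shift_mul, ← P.shift_mul, h] at this
  exact this rfl

lemma Par.asym {m s d : ℤ} {a b : ℤ → ℤ} (P : Par m s d a b) {k : ℕ} (hk : 2 * (k : ℤ) + 4 < s)
    {w w' : ℤ → Prop} (h : ¬ (w 0 ↔ w' 0)) :
    ¬ ∃ c : ℤ, ∀ h : ℤ, 0 ≤ h → h < 8 * s * m → th m a b (Zs s w) h ≠ th m a b (Zs s w') h →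
      ∃ h' q : ℤ, 0 ≤ h' ∧ h' < 8 * s * m ∧ th m a b (Zs s w) h' ≠ th m a b (Zs s w') h' ∧
        |h + h' - c - q * (8 * s * m)| ≤ k := by
  rintro ⟨c, hc⟩
  have hm : 0 < m := by linarith [P.d0, P.dm]
  have hs := P.hs
  have key : ∀ α : ℤ, (α = 1 ∨ α = 2 ∨ α = 4) → ∃ α' q : ℤ, (α' = 1 ∨ α' = 2 ∨ α' = 4) ∧
      -(k : ℤ) ≤ (s * m) * (α + α' - 8 * q) - c + d + m ∧
      (s * m) * (α + α' - 8 * q) - c + d - m ≤ k ∧ 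
      -(k : ℤ) - m ≤ (s * m) * (α + α' - 8 * q) - c + d ∧
      (s * m) * (α + α' - 8 * q) - c + d ≤ k := by
    intro α hα
    have hd := (P.diff h (q := α * s) (e := d) (by rcases hα with rfl | rfl | rfl <;> omega)
      (by rcases hα with rfl | rfl | rfl <;> omega) P.d0 P.dm).2
      ⟨by rcases hα with rfl | rfl | rfl <;> omega, P.hd⟩
    obtain ⟨h', q, h0, h1, h2, h3⟩ := hc (α * s * m + d)
      (by have := P.d0; rcases hα with rfl | rfl | rfl <;> nlinarith)
      (by have := P.dm; rcases hα with rfl | rfl | rfl <;> nlinarith) hd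
    obtain ⟨r, e, rfl, e0, e1⟩ := decomp hm h'
    have hr0 : 0 ≤ r := by nlinarith
    have hr1 : r < 8 * s := by nlinarith
    obtain ⟨h4, -⟩ := (P.diff h hr0 hr1 e0 e1).1 h2
    rw [abs_le] at h3
    obtain ⟨α', hα', rfl⟩ : ∃ α' : ℤ, (α' = 1 ∨ α' = 2 ∨ α' = 4) ∧ r = α' * s := by
      rcases h4 with rfl | rfl | rfl
      · exact ⟨1, by simp⟩
      · exact ⟨2, by simp⟩
      · exact ⟨4, by simp⟩
    have e3 : α * s * m + d + (α' * s * m + e) - c - q * (8 * s * m) =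
      (s * m) * (α + α' - 8 * q) - c + d + e := by ring
    rw [e3] at h3
    refine ⟨α', q, hα', ?_, ?_, ?_, ?_⟩ <;> linarith
  have eqv : ∀ A B : ℤ, -(k : ℤ) - m ≤ (s * m) * A - c + d → (s * m) * A - c + d ≤ k →
      -(k : ℤ) - m ≤ (s * m) * B - c + d → (s * m) * B - c + d ≤ k → A ≤ B := by
    intro A B h1 h2 h3 h4
    by_contra hlt
    have h5 : B + 1 ≤ A := by omega
    have h6 : (s * m) * (B + 1) ≤ (s * m) * A :=
      mul_le_mul_of_nonneg_left h5 (by positivity)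
    have h7 : (2 * (k : ℤ) + 5) * m ≤ s * m := mul_le_mul_of_nonneg_right (by omega) hm.le
    nlinarith
  obtain ⟨a1, q1, ha1, -, -, h1, h1'⟩ := key 1 (by simp)
  obtain ⟨a2, q2, ha2, -, -, h2, h2'⟩ := key 2 (by simp)
  obtain ⟨a4, q4, ha4, -, -, h4, h4'⟩ := key 4 (by simp)
  have x12 := eqv _ _ h1 h1' h2 h2'
  have x21 := eqv _ _ h2 h2' h1 h1'
  have x14 := eqv _ _ h1 h1' h4 h4'
  have x41 := eqv _ _ h4 h4' h1 h1'
  clear key eqv hc h1 h1' h2 h2' h4 h4'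
  rcases ha1 with rfl | rfl | rfl <;> rcases ha2 with rfl | rfl | rfl <;>
    rcases ha4 with rfl | rfl | rfl <;> omega


end Part5

section Part6

/-! ### Part 6: conclusion -/

/-- Some letter has infinitely many indicator sequences. -/
lemma GoodS.letter {X : Set (ℤ → ℤ)} (h : GoodS X) :
    ∃ α : ℤ, ((fun (x : ℤ → ℤ) (i : ℤ) => x i = α) '' X).Infinite := by
  by_contra hcon
  push Not at hcon
  have hF : ((fun x : ℤ → ℤ => x 0) '' X).Finite :=
    (h.cpt.image (continuous_apply 0)).finite_of_discrete
  set F := (fun x : ℤ → ℤ => x 0) '' X with hFdef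
  have hFin := hF.to_subtype
  have hpi : (Set.pi univ (fun α : ↥F => (fun (x : ℤ → ℤ) (i : ℤ) => x i = α.1) '' X)).Finite :=
    Set.Finite.pi (fun α => hcon α.1)
  apply h.inf
  have himg : ((fun (x : ℤ → ℤ) (α : ↥F) (i : ℤ) => x i = α.1) '' X).Finite := by
    refine hpi.subset ?_
    rintro _ ⟨x, hx, rfl⟩ α _
    exact ⟨x, hx, rfl⟩
  refine himg.of_finite_image ?_
  intro x hx y hy hxy
  funext i
  have hmem : y i ∈ F := ⟨shiftBy i y, h.inv y hy i, by simp [shiftBy]⟩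
  have := congrFun (congrFun hxy ⟨y i, hmem⟩) i
  simpa using this

lemma density (X : SubshiftSpace) (hX : X ∈ MinimalSet) (n k : ℕ) :
    ∃ Y : SubshiftSpace, Y ∈ MinimalSet ∧ Lang n Y.carrier = Lang n X.carrier ∧
      CutProp k Y.carrier := by
  have h := goodS_of_mem X hX
  obtain ⟨m, a, b, hab, hlang⟩ := h.blocks n
  obtain ⟨α, hα⟩ := h.letter
  -- minimal difference
  obtain ⟨d, d0, dm, hd, mind⟩ : ∃ d : ℤ, 0 ≤ d ∧ d < m ∧ a d ≠ b d ∧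
      ∀ e : ℤ, 0 ≤ e → e < d → a e = b e := by
    classical
    have hex : ∃ d : ℕ, a d ≠ b d := by
      obtain ⟨d, d0, -, hd⟩ := hab
      exact ⟨d.toNat, by rwa [Int.toNat_of_nonneg d0]⟩
    refine ⟨Nat.find hex, by positivity, ?_, Nat.find_spec hex, ?_⟩
    · obtain ⟨d, d0, d1, hd⟩ := hab
      have := Nat.find_min' hex (m := d.toNat) (by rwa [Int.toNat_of_nonneg d0])
      omega
    · intro e e0 e1
      by_contra hne
      have := Nat.find_min' hex (m := e.toNat) (by rwa [Int.toNat_of_nonneg e0])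
      omega
  set s : ℕ := (2 * k + 10) * k.factorial with hsdef
  have hs1 : 2 * k + 10 ≤ s := Nat.le_mul_of_pos_right _ k.factorial_pos
  have P : Par m s d a b := ⟨by omega, d0, dm, hd, mind⟩
  have hm : 0 < m := by omega
  set p : ℕ := 8 * s * m with hp
  have hp0 : 0 < p := by positivity
  have hpz : (p : ℤ) = 8 * s * m := by rw [hp]; push_cast; ring
  let Φ : (ℤ → ℤ) → (ℤ → ℤ) := fun x => th m a b (Zs s (fun i => x i = α))
  have hΦsh : ∀ x Q, Φ (shiftBy Q x) = shiftBy (Q * p) (Φ x) := by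
    intro x Q
    rw [hpz]
    exact (P.shift_mul (fun i => x i = α) Q).symm
  have hΦc : Continuous Φ := by
    classical
    refine continuous_pi fun i => ?_
    let f : ℤ → ℤ := fun c =>
      if CW s (c = α) (i / m % (8 * s)) then b (i % m) else a (i % m)
    have : (fun x => Φ x i) = fun x => f (x (i / m / (8 * s))) := by
      funext x
      simp only [Φ, th, Zs, f]
      congr
    rw [this]
    exact (continuous_of_discreteTopology (f := f)).comp (continuous_apply _)
  let Y : Set (ℤ → ℤ) := {y | ∃ x ∈ X.carrier, ∃ j : ℤ, y = shiftBy j (Φ x)}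
  have hYinv : ∀ y ∈ Y, ∀ i : ℤ, shiftBy i y ∈ Y := by
    rintro _ ⟨x, hx, j, rfl⟩ i
    exact ⟨x, hx, i + j, shiftBy_shiftBy _ _ _⟩
  have hYc : IsCompact Y := by
    have : Y = ⋃ j ∈ Set.Ico (0 : ℤ) p, (fun x => shiftBy j (Φ x)) '' X.carrier := by
      ext y
      simp only [mem_iUnion, mem_image, exists_prop]
      constructor
      · rintro ⟨x, hx, j, rfl⟩
        obtain ⟨q, e, rfl, e0, e1⟩ := decomp (m := p) (by exact_mod_cast hp0) j
        refine ⟨e, ⟨e0, e1⟩, shiftBy q x, h.inv x hx q, ?_⟩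
        rw [hΦsh, shiftBy_shiftBy, add_comm]
      · rintro ⟨j, -, x, hx, rfl⟩
        exact ⟨x, hx, j, rfl⟩
    rw [this]
    exact (Set.finite_Ico _ _).isCompact_biUnion
      (fun j _ => h.cpt.image ((continuous_shiftBy j).comp hΦc))
  have hYne : Y.Nonempty := by
    obtain ⟨x, hx⟩ := h.ne
    exact ⟨_, x, hx, 0, rfl⟩
  have hYshift : shift '' Y = Y := by
    apply Subset.antisymm
    · rintro _ ⟨y, hy, rfl⟩
      rw [shift_eq]; exact hYinv y hy 1
    · intro y hy
      refine ⟨shiftBy (-1) y, hYinv y hy _, ?_⟩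
      rw [shift_eq, shiftBy_shiftBy]
      exact shiftBy_zero y
  have hYinf : Y.Infinite := by
    have : ((fun w : ℤ → Prop => th m a b (Zs s w)) ''
        ((fun (x : ℤ → ℤ) (i : ℤ) => x i = α) '' X.carrier)).Infinite :=
      hα.image (fun w _ w' _ hw => P.inj hw)
    refine this.mono ?_
    rintro _ ⟨_, ⟨x, hx, rfl⟩, rfl⟩
    exact ⟨x, hx, 0, (shiftBy_zero _).symm⟩
  have hYmin : ∀ y ∈ Y, Y ⊆ closure (orbit y) := by
    rintro _ ⟨x, hx, j, rfl⟩ _ ⟨x2, hx2, j2, rfl⟩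
    rw [mem_closure_iff]
    intro O hO hmem
    have hO' : IsOpen ((fun x => shiftBy j2 (Φ x)) ⁻¹' O) :=
      hO.preimage ((continuous_shiftBy j2).comp hΦc)
    obtain ⟨q, hq⟩ := h.visit hx hx2 hO' hmem
    refine ⟨_, hq, j2 + q * p - j, ?_⟩
    simp only [hΦsh, shiftBy_shiftBy]
    congr 1; ring
  refine ⟨⟨Y, hYne, hYc, hYshift⟩, ⟨hYinf, hYmin⟩, ?_, ?_⟩
  · ext l
    constructor
    · rintro ⟨_, ⟨x, hx, j, rfl⟩, i, rfl⟩
      obtain ⟨x', hx', Q, hQ⟩ := (hlang (Zs s (fun i => x i = α))).1 (i + j)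
      refine ⟨x', hx', Q, ?_⟩
      rw [factorAt_ext]
      intro t t0 t1
      rw [← hQ t t0 t1]
      simp only [shiftBy, Φ]
      congr 1; ring
    · rintro ⟨x, hx, Q, rfl⟩
      obtain ⟨i, hi⟩ := (hlang (Zs s (fun i => x i = α))).2 x hx Q
      refine ⟨Φ x, ⟨x, hx, 0, (shiftBy_zero _).symm⟩, i, ?_⟩
      rw [factorAt_ext]
      intro t t0 t1
      exact (hi t t0 t1).symm
  · have htf : ¬ ((fun _ : ℤ => False) 0 ↔ (fun _ : ℤ => True) 0) := by simp
    have hnd : ∀ i : ℤ, 0 ≤ i → i < p → (i / m < s ∨ 4 * s < i / m) →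
        th m a b (Zs s (fun _ => False)) i = th m a b (Zs s (fun _ => True)) i := by
      intro i i0 i1 hi
      by_contra hne
      obtain ⟨q, e, rfl, e0, e1⟩ := decomp (m := m) (by exact_mod_cast hm) i
      have eq : (q * m + e) / m = q := by
        rw [add_comm, Int.add_mul_ediv_right _ _ (by omega), Int.ediv_eq_zero_of_lt e0 e1, zero_add]
      rw [eq] at hi
      rw [hpz] at i1
      have hq0 : 0 ≤ q := by nlinarith
      have hq1 : q < 8 * s := by nlinarith
      have := ((P.diff htf hq0 hq1 e0 e1).1 hne).1
      omega
    have hpbig : (s : ℤ) ≤ p := by rw [hpz]; nlinarith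
    refine ⟨p, 7 * m + d.toNat + 1, TE m d, th m a b (Zs s (fun _ => False)),
      th m a b (Zs s (fun _ => True)), hp0, ?_, ?_, ?_, ?_, ?_, ?_, ?_⟩
    · intro q q0 q1
      have : q ∣ s := Dvd.dvd.mul_left (Nat.dvd_factorial q0 q1) _
      exact Dvd.dvd.mul_right (Dvd.dvd.mul_left this 8) m
    · rintro x y hxy ⟨h1, h2⟩
      push_cast at hxy
      refine ⟨fun i i0 i1 => ?_, ?_⟩
      · rw [← hxy _ (by omega) (by omega), ← hxy _ (by omega) (by omega)]
        exact h1 i i0 i1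
      · rw [← hxy _ (by omega) (by omega), ← hxy _ (by omega) (by omega)]
        exact h2
    · rintro _ ⟨x, hx, j, rfl⟩
      have ht : ∀ t : ℤ, shiftBy t (shiftBy j (Φ x)) ∈ TE m d ↔ ∃ Q : ℤ, t + j = Q * p := by
        intro t
        rw [shiftBy_shiftBy, hpz]
        exact P.test _ _
      obtain ⟨q, e, hj, e0, e1⟩ := decomp (m := p) (by exact_mod_cast hp0) (-j)
      refine ⟨e, ⟨e0, e1, (ht e).2 ⟨-q, by linarith⟩⟩, ?_⟩
      rintro t ⟨t0, t1, t2⟩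
      obtain ⟨Q, hQ⟩ := (ht t).1 t2
      have h1 : t - e = (Q + q) * p := by linarith
      have h2 : Q + q = 0 := by
        by_contra hne
        rcases lt_or_gt_of_ne hne with h3 | h3
        · have : (Q + q) * p ≤ -1 * p := mul_le_mul_of_nonneg_right (by omega) (by positivity)
          omega
        · have : 1 * (p : ℤ) ≤ (Q + q) * p := mul_le_mul_of_nonneg_right (by omega) (by positivity)
          omega
      rw [h2] at h1
      omega
    · rintro _ ⟨x, hx, j, rfl⟩ hE
      obtain ⟨Q, hQ⟩ := (P.test _ _).1 hE
      have e1 : shiftBy j (Φ x) = th m a b (Zs s (shiftBy Q (fun i => x i = α))) := by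
        rw [hQ]; exact P.shift_mul _ _
      rw [e1]
      by_cases hx0 : shiftBy Q (fun i => x i = α) 0
      · right
        intro i i0 i1
        exact P.first (by simp [hx0]) i0 (by rwa [← hpz])
      · left
        intro i i0 i1
        exact P.first (by simp [hx0]) i0 (by rwa [← hpz])
    · intro i i0 i1
      apply hnd i i0 (by omega)
      left
      have : i / m ≤ i := Int.ediv_le_self _ i0
      omega
    · intro i i0 i1
      apply hnd i (by omega) i1
      right
      have h1 : (4 * s + 1 : ℤ) ≤ i / m := by
        rw [Int.le_ediv_iff_mul_le (by omega)]
        rw [hpz] at i0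
        have : (1 : ℤ) ≤ m := by omega
        have h2 : (k : ℤ) ≤ (4 * s - 1) := by omega
        have h3 : (4 * (s : ℤ) - 1) ≤ (4 * s - 1) * m := le_mul_of_one_le_right (by omega) this
        have h4 : (4 * (s : ℤ) + 1) * m = 8 * s * m - (4 * s - 1) * m := by ring
        omega
      omega
    · rw [hpz]
      exact P.asym (by omega) htf


end Part6


/-- In the Polish space `𝐌` of infinite minimal subshifts, the set of
strong Toeplitz subshifts of rank 2 which are not conjugate to their inverses is
comeager. -/
theorem statement15 :
    {X : ↥MinimalSet | IsStrongToeplitzOfRank (X : SubshiftSpace).carrier 2 ∧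
        ¬ ConjugateBy (X : SubshiftSpace).carrier (X : SubshiftSpace).carrier
            shift shiftInv}
      ∈ residual ↥MinimalSet := by
  refine residual_of density ?_
  intro X hC
  have good := goodS_of_mem X.1 X.2
  obtain ⟨G, p, T⟩ := exists_tower good hC
  exact ⟨T.strong, not_conj_inv good hC⟩

end ToeplitzFR
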